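/- arXiv:2302.06396 — 2 statements merged into one kernel-verified Lean document; each statement's English description precedes it below -/
import Mathlib

section
/- If L ∈ K[D] has a pseudoconstant, i.e., an element [P]_L of K[D]/⟨L⟩ that is completely integral but not a constant, then L admits at least one transcendental solution (equivalently, it is not the case that all solutions of L are algebraic over K). -/
/- Framework: linear differential operators over K = C(x), represented as
   `Polynomial (RatFunc C)` where `X^i` stands for `D^i` (coefficients on the left);
   local (Puiseux/Hahn series) solutions at finite points and at infinity;
   integrality; constants and pseudoconstants of `K[D]/⟨L⟩`. -/

noncomputable section
open Polynomial

variable (C : Type) [Field C] [IsAlgClosed C] [CharZero C]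

/-- The derivative d/dx on K = C(x). -/
def KDeriv (r : RatFunc C) : RatFunc C :=
  (algebraMap (Polynomial C) (RatFunc C) (derivative r.num) * algebraMap _ _ r.denom
    - algebraMap _ _ r.num * algebraMap _ _ (derivative r.denom))
  / (algebraMap (Polynomial C) (RatFunc C) r.denom) ^ 2

/-- Linear differential operators `∑ aᵢ Dⁱ` with `aᵢ ∈ C(x)`, encoded as polynomials
    whose `i`-th coefficient is the coefficient of `Dⁱ`. -/
abbrev DOp := Polynomial (RatFunc C)

/-- Left multiplication by `D` in `K[D]`: `D·(∑ aᵢ Dⁱ) = ∑ aᵢ Dⁱ⁺¹ + ∑ aᵢ' Dⁱ`. -/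
def Dmul (P : DOp C) : DOp C :=
  X * P + P.sum fun i a => Polynomial.C (KDeriv C a) * X ^ i

/-- Multiplication (composition) in the noncommutative ring `K[D]`. -/
def opMul (P Q : DOp C) : DOp C :=
  P.sum fun i a => Polynomial.C a * (Dmul C)^[i] Q

/-- The adjoint `L ↦ L*`: `(∑ aᵢ Dⁱ)* = ∑ (−D)ⁱ aᵢ`. -/
def adjoint (L : DOp C) : DOp C :=
  L.sum fun i a => (-1) ^ i * (Dmul C)^[i] (Polynomial.C a)

/-- Application of an operator to an element of `K` itself (rational solutions). -/
def KApply (L : DOp C) (q : RatFunc C) : RatFunc C :=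
  L.sum fun i a => a * (KDeriv C)^[i] q

/-- `[P]_L` is zero in `K[D]/⟨L⟩`, i.e. `P` is a left multiple of `L`. -/
def IsZeroClass (L P : DOp C) : Prop := ∃ Q : DOp C, P = opMul C Q L

/-- `[P]_L` is a constant of `K[D]/⟨L⟩`, i.e. `D·[P]_L = [0]_L`. -/
def IsConstantClass (L P : DOp C) : Prop := ∃ Q : DOp C, Dmul C P = opMul C Q L

/-- `N = lclm(L, M)`: the monic common left multiple of `L` and `M` of lowest order. -/
def IsLCLM (L M N : DOp C) : Prop :=
  N.Monic ∧ (∃ A, N = opMul C A L) ∧ (∃ B, N = opMul C B M) ∧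
    ∀ N' : DOp C, N'.Monic → (∃ A, N' = opMul C A L) → (∃ B, N' = opMul C B M) →
      N.natDegree ≤ N'.natDegree

/-- A differential field extension of `K = C(x)`. -/
structure DiffExt where
  carrier : Type
  [isField : Field carrier]
  [isAlgK : Algebra (RatFunc C) carrier]
  [isAlgC : Algebra C carrier]
  [isTower : IsScalarTower C (RatFunc C) carrier]
  δ : carrier → carrier
  δ_add : ∀ a b, δ (a + b) = δ a + δ b
  δ_mul : ∀ a b, δ (a * b) = a * δ b + δ a * b
  δ_algebraMap : ∀ r : RatFunc C,
    δ (algebraMap (RatFunc C) carrier r) = algebraMap (RatFunc C) carrier (KDeriv C r)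

attribute [instance] DiffExt.isField DiffExt.isAlgK DiffExt.isAlgC DiffExt.isTower

/-- Application of an operator `L = ∑ aᵢ Dⁱ` to an element of a differential extension. -/
def DiffExt.apply (F : DiffExt C) (L : DOp C) (f : F.carrier) : F.carrier :=
  L.sum fun i a => algebraMap (RatFunc C) F.carrier a * F.δ^[i] f

/-- Formal derivative `d/dt` on generalized (Hahn/Puiseux) series with rational exponents. -/
def hderiv (f : HahnSeries ℚ C) : HahnSeries ℚ C :=
  HahnSeries.embDomain (OrderIso.addRight (-1 : ℚ)).toOrderEmbedding
    { coeff := fun γ => γ • f.coeff γ,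
      isPWO_support' := f.isPWO_support.mono (by
        intro γ hγ
        simp only [Function.mem_support, ne_eq] at hγ ⊢
        intro hc
        exact hγ (by rw [hc, smul_zero]) ) }

/-- The derivation `d/dx = -t² d/dt` on series at infinity, in the local coordinate `t = 1/x`. -/
def dinf (f : HahnSeries ℚ C) : HahnSeries ℚ C :=
  -(HahnSeries.single (2 : ℚ) (1 : C) * hderiv C f)

/-- `ι` is a series expansion of `C(x)` (at a finite point for `δ = hderiv`, at infinity
    for `δ = dinf`), i.e. a ring embedding compatible with differentiation. -/
def IsExpansion (δ : HahnSeries ℚ C → HahnSeries ℚ C)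
    (ι : RatFunc C →+* HahnSeries ℚ C) : Prop :=
  ∀ r, ι (KDeriv C r) = δ (ι r)

/-- Application of an operator to a local series solution via the expansion `ι`. -/
def localApply (δ : HahnSeries ℚ C → HahnSeries ℚ C)
    (ι : RatFunc C →+* HahnSeries ℚ C) (L : DOp C) (f : HahnSeries ℚ C) : HahnSeries ℚ C :=
  L.sum fun i a => ι a * δ^[i] f

/-- A series is integral if it has no pole, i.e. all exponents are ≥ 0. -/
def IntegralSeries (f : HahnSeries ℚ C) : Prop := ∀ γ < (0 : ℚ), f.coeff γ = 0

/-- `[P]_L` is completely integral: at every point of `C ∪ {∞}` and every local series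
    solution `f` of `L` there, `P·f` has no pole. -/
def CompletelyIntegral (L P : DOp C) : Prop :=
  ∀ δ ∈ ({hderiv C, dinf C} : Set (HahnSeries ℚ C → HahnSeries ℚ C)),
    ∀ ι : RatFunc C →+* HahnSeries ℚ C, IsExpansion C δ ι →
      ∀ f : HahnSeries ℚ C, localApply C δ ι L f = 0 →
        IntegralSeries C (localApply C δ ι P f)

/-- A pseudoconstant of `L`: a completely integral element of `K[D]/⟨L⟩` that is not
    a constant. -/
def IsPseudoconstant (L P : DOp C) : Prop :=
  CompletelyIntegral C L P ∧ ¬ IsConstantClass C L P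

def HasPseudoconstant (L : DOp C) : Prop := ∃ P : DOp C, IsPseudoconstant C L P

/-- `S` is the `s`-th symmetric power of `L`: the monic operator of minimal order
    annihilating all products of `s` solutions of `L`. -/
def IsSymPow (L S : DOp C) (s : ℕ) : Prop :=
  S.Monic ∧
  (∀ F : DiffExt C, ∀ f : Fin s → F.carrier,
      (∀ i, F.apply C L (f i) = 0) → F.apply C S (∏ i, f i) = 0) ∧
  (∀ S' : DOp C, S'.Monic →
      (∀ F : DiffExt C, ∀ f : Fin s → F.carrier,
        (∀ i, F.apply C L (f i) = 0) → F.apply C S' (∏ i, f i) = 0) →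
      S.natDegree ≤ S'.natDegree)

/-- `L` has only algebraic solutions: there is an algebraic differential extension of `K`
    in which the solution space of `L` has dimension `ord L`. -/
def AllAlgebraic (L : DOp C) : Prop :=
  ∃ F : DiffExt C, Algebra.IsAlgebraic (RatFunc C) F.carrier ∧
    ∃ b : Fin L.natDegree → F.carrier,
      (∀ i, F.apply C L (b i) = 0) ∧ LinearIndependent C b

set_option linter.unusedSectionVars false

namespace PsC


theorem bezout_deg {k : Type*} [Field k] {g0 h0 r : k[X]} (hg : g0.Monic) (hh : h0.Monic)
    (hc : IsCoprime g0 h0) (hr : r.degree < (g0 * h0).degree) :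
    ∃ p : k[X] × k[X], p.1.degree < g0.degree ∧ p.2.degree < h0.degree ∧
      g0 * p.2 + p.1 * h0 = r := by
  obtain ⟨u, v, huv⟩ := hc
  have hg0 : g0 ≠ 0 := hg.ne_zero
  have hh0 : h0 ≠ 0 := hh.ne_zero
  have hdvd : g0 ∣ r - ((r * v) %ₘ g0) * h0 := by
    refine ⟨r * u + (r * v /ₘ g0) * h0, ?_⟩
    have := modByMonic_add_div (r * v) g0
    linear_combination (-r) * huv - h0 * this
  obtain ⟨a, ha⟩ := hdvd
  have hb : ((r * v) %ₘ g0).degree < g0.degree := degree_modByMonic_lt _ hg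
  refine ⟨((r * v) %ₘ g0, a), hb, ?_, by linear_combination -ha⟩
  have h1 : (g0 * a).degree < (g0 * h0).degree := by
    rw [← ha]
    refine (degree_sub_le _ _).trans_lt (max_lt hr ?_)
    rw [degree_mul, degree_mul]
    exact WithBot.add_lt_add_right (by simpa using hh0) hb
  rw [degree_mul, degree_mul] at h1
  exact lt_of_add_lt_add_left h1

def hseq {k : Type*} [Field k] (S : k[X] → k[X] × k[X]) (q : ℕ → k[X]) (g0 h0 : k[X]) :
    ℕ → k[X] × k[X]
  | 0 => (g0, h0)
  | n + 1 => S (q (n + 1) - ∑ i : Fin n, (hseq S q g0 h0 (i + 1)).1 * (hseq S q g0 h0 (n - i)).2)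
termination_by n => n
decreasing_by
  · omega
  · omega

theorem hensel_seq {k : Type*} [Field k] {g0 h0 : k[X]} (hg : g0.Monic) (hh : h0.Monic)
    (hc : IsCoprime g0 h0) (q : ℕ → k[X]) (hq0 : q 0 = g0 * h0)
    (hq : ∀ n, (q (n + 1)).degree < (g0 * h0).degree) :
    ∃ g h : ℕ → k[X], (∀ n, (g n).degree ≤ g0.degree) ∧ (∀ n, (h n).degree ≤ h0.degree) ∧
      ∀ n, ∑ ij ∈ Finset.HasAntidiagonal.antidiagonal n, g ij.1 * h ij.2 = q n := by
  have : ∀ r : k[X], ∃ p : k[X] × k[X], r.degree < (g0 * h0).degree →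
      p.1.degree < g0.degree ∧ p.2.degree < h0.degree ∧ g0 * p.2 + p.1 * h0 = r := by
    intro r
    by_cases hr : r.degree < (g0 * h0).degree
    · obtain ⟨p, hp⟩ := bezout_deg hg hh hc hr
      exact ⟨p, fun _ => hp⟩
    · exact ⟨0, fun h => absurd h hr⟩
  choose S hS using this
  set f := hseq S q g0 h0 with hf
  have f0 : f 0 = (g0, h0) := by rw [hf, hseq]
  have fs : ∀ n, f (n + 1) = S (q (n + 1) - ∑ i : Fin n, (f (i + 1)).1 * (f (n - i)).2) := by
    intro n; rw [hf, hseq]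
  have key : ∀ n, (f (n + 1)).1.degree < g0.degree ∧ (f (n + 1)).2.degree < h0.degree ∧
      g0 * (f (n + 1)).2 + (f (n + 1)).1 * h0 =
        q (n + 1) - ∑ i : Fin n, (f (i + 1)).1 * (f (n - i)).2 := by
    intro n
    induction n using Nat.strong_induction_on with
    | _ n ih =>
      rw [fs]
      apply hS
      refine (degree_sub_le _ _).trans_lt (max_lt (hq n) ?_)
      refine (degree_sum_le _ _).trans_lt ?_
      rw [Finset.sup_lt_iff (by simpa [bot_lt_iff_ne_bot] using ⟨hg.ne_zero, hh.ne_zero⟩)]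
      intro i _
      have h1 := (ih i i.2).1
      have h2 := (ih (n - i - 1) (by omega)).2.1
      rw [show n - i - 1 + 1 = n - (i : ℕ) by omega] at h2
      rw [degree_mul, degree_mul]
      exact (add_le_add_left h1.le _).trans_lt
        (WithBot.add_lt_add_left (by simpa using hg.ne_zero) h2)
  refine ⟨fun n => (f n).1, fun n => (f n).2, ?_, ?_, ?_⟩
  · rintro (_ | n)
    · simp [f0]
    · exact (key n).1.le
  · rintro (_ | n)
    · simp [f0]
    · exact (key n).2.1.le
  · rintro (_ | n)
    · simp [f0, hq0]
    · rw [Finset.Nat.sum_antidiagonal_eq_sum_range_succ (fun i j => (f i).1 * (f j).2),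
        Finset.sum_range_succ, Finset.sum_range_succ', ]
      have := (key n).2.2
      rw [Fin.sum_univ_eq_sum_range (fun i => (f (i + 1)).1 * (f (n - i)).2) n] at this
      simp only [f0, Nat.sub_self, Nat.sub_zero, Nat.add_sub_add_right]
      linear_combination this

theorem hensel_ps {k : Type*} [Field k] {g0 h0 : k[X]} (hg : g0.Monic) (hh : h0.Monic)
    (hc : IsCoprime g0 h0) (q : (PowerSeries k)[X]) (hqm : q.Monic)
    (hq0 : q.map PowerSeries.constantCoeff = g0 * h0) :
    ∃ g h : (PowerSeries k)[X], q = g * h ∧ g.natDegree ≤ g0.natDegree ∧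
      h.natDegree ≤ h0.natDegree := by
  have hdeg : (g0 * h0).degree = q.natDegree := by
    rw [← hq0, hqm.degree_map, degree_eq_natDegree hqm.ne_zero]
  set Q : ℕ → k[X] := fun n => ∑ i ∈ Finset.range (q.natDegree + 1),
    monomial i (PowerSeries.coeff n (q.coeff i)) with hQ
  have hQc : ∀ n i, (Q n).coeff i = PowerSeries.coeff n (q.coeff i) := by
    intro n i
    simp only [hQ, finsetSum_coeff, coeff_monomial, Finset.sum_ite_eq', Finset.mem_range]
    split_ifs with h
    · rfl
    · rw [coeff_eq_zero_of_natDegree_lt (by omega), map_zero]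
  obtain ⟨g, h, hgd, hhd, hgh⟩ := hensel_seq hg hh hc Q
    (by ext i; rw [hQc, ← hq0, coeff_map]; simp)
    (by
      intro n
      rw [hdeg, degree_lt_iff_coeff_zero]
      intro m hm
      rw [hQc]
      rcases hm.eq_or_lt with h | h
      · rw [← h, hqm.coeff_natDegree, PowerSeries.coeff_one]; simp
      · rw [coeff_eq_zero_of_natDegree_lt h, map_zero])
  have hlift : ∀ (u : ℕ → k[X]) (d : ℕ), (∀ n, (u n).natDegree ≤ d) →
      ∃ U : (PowerSeries k)[X], U.natDegree ≤ d ∧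
        ∀ n i, PowerSeries.coeff n (U.coeff i) = (u n).coeff i := by
    intro u d hu
    refine ⟨∑ i ∈ Finset.range (d + 1), monomial i (PowerSeries.mk fun n => (u n).coeff i), ?_, ?_⟩
    · refine natDegree_sum_le_of_forall_le _ _ fun i hi => (natDegree_monomial_le _).trans ?_
      have := Finset.mem_range.1 hi
      omega
    · intro n i
      simp only [finsetSum_coeff, coeff_monomial, Finset.sum_ite_eq', Finset.mem_range]
      split_ifs with h
      · simp
      · rw [coeff_eq_zero_of_natDegree_lt (by have := hu n; omega), map_zero]
  obtain ⟨G, hG, hGc⟩ := hlift g g0.natDegree fun n => natDegree_le_natDegree (hgd n)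
  obtain ⟨H, hH, hHc⟩ := hlift h h0.natDegree fun n => natDegree_le_natDegree (hhd n)
  refine ⟨G, H, ?_, hG, hH⟩
  ext i n
  rw [← hQc, ← hgh, coeff_mul, map_sum, finsetSum_coeff]
  simp only [PowerSeries.coeff_mul, coeff_mul, hGc, hHc]
  rw [Finset.sum_comm]


theorem hensel_monic {k : Type*} [Field k] {g0 h0 : k[X]} (hg : g0.Monic) (hh : h0.Monic)
    (hc : IsCoprime g0 h0) (q : (PowerSeries k)[X]) (hqm : q.Monic)
    (hq0 : q.map PowerSeries.constantCoeff = g0 * h0) :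
    ∃ g h : (PowerSeries k)[X], q = g * h ∧ g.Monic ∧ h.Monic ∧ g.natDegree ≤ g0.natDegree ∧
      h.natDegree ≤ h0.natDegree := by
  obtain ⟨g, h, hgh, h1, h2⟩ := hensel_ps hg hh hc q hqm hq0
  have hlc : g.leadingCoeff * h.leadingCoeff = 1 := by
    rw [← leadingCoeff_mul, ← hgh, hqm.leadingCoeff]
  refine ⟨Polynomial.C h.leadingCoeff * g, Polynomial.C g.leadingCoeff * h, ?_, ?_, ?_,
    (natDegree_C_mul_le _ _).trans h1, (natDegree_C_mul_le _ _).trans h2⟩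
  · rw [hgh]
    have : (Polynomial.C h.leadingCoeff * Polynomial.C g.leadingCoeff : (PowerSeries k)[X]) = 1 := by
      rw [← C_mul, mul_comm, hlc, C_1]
    linear_combination (-(g * h)) * this
  · rw [Monic, leadingCoeff_mul, leadingCoeff_C, mul_comm, hlc]
  · rw [Monic, leadingCoeff_mul, leadingCoeff_C, hlc]

/-- `t ↦ t^c` -/
def em (k : Type*) [Field k] (c : ℚ) (hc : 0 < c) : HahnSeries ℤ k →+* HahnSeries ℚ k :=
  HahnSeries.embDomainRingHom ((AddMonoidHom.mulLeft c).comp (Int.castAddHom ℚ))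
    (fun a b h => by simpa [hc.ne'] using h)
    (fun a b => by simp [hc])

theorem em_coeff {k : Type*} [Field k] (c : ℚ) (hc : 0 < c) (f : HahnSeries ℤ k) (z : ℤ) :
    (em k c hc f).coeff (c * z) = f.coeff z :=
  HahnSeries.embDomain_coeff (f := ⟨⟨((AddMonoidHom.mulLeft c).comp (Int.castAddHom ℚ)),
    (fun a b h => by simpa [hc.ne'] using h)⟩, by simp [hc]⟩) (a := z)

theorem em_coeff_ne {k : Type*} [Field k] (c : ℚ) (hc : 0 < c) (f : HahnSeries ℤ k) (γ : ℚ)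
    (h : (em k c hc f).coeff γ ≠ 0) : ∃ z : ℤ, γ = c * z ∧ f.coeff z ≠ 0 := by
  obtain ⟨z, hz, hz'⟩ := HahnSeries.support_embDomain_subset h
  exact ⟨z, hz'.symm, hz⟩

theorem em_single {k : Type*} [Field k] (c : ℚ) (hc : 0 < c) (z : ℤ) (a : k) :
    em k c hc (HahnSeries.single z a) = HahnSeries.single (c * z) a :=
  HahnSeries.embDomain_single

/-- power series in `t^c` -/
def rho (k : Type*) [Field k] (c : ℚ) (hc : 0 < c) : PowerSeries k →+* HahnSeries ℚ k :=
  (em k c hc).comp (HahnSeries.ofPowerSeries ℤ k)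

theorem rho_coeff {k : Type*} [Field k] (c : ℚ) (hc : 0 < c) (f : PowerSeries k) (n : ℕ) :
    (rho k c hc f).coeff (c * n) = PowerSeries.coeff n f := by
  have := em_coeff c hc (HahnSeries.ofPowerSeries ℤ k f) n
  rw [HahnSeries.ofPowerSeries_apply_coeff] at this
  simpa [rho] using this

theorem rho_coeff_ne {k : Type*} [Field k] (c : ℚ) (hc : 0 < c) (f : PowerSeries k) (γ : ℚ)
    (h : (rho k c hc f).coeff γ ≠ 0) : ∃ n : ℕ, γ = c * n := by
  obtain ⟨z, hz, hz'⟩ := em_coeff_ne c hc _ γ h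
  rw [HahnSeries.ofPowerSeries_apply] at hz'
  obtain ⟨n, hn, hn'⟩ := HahnSeries.support_embDomain_subset hz'
  refine ⟨n, ?_⟩
  rw [hz, ← hn']; simp

theorem exists_rho {k : Type*} [Field k] (c : ℚ) (hc : 0 < c) (f : HahnSeries ℚ k)
    (h : ∀ γ, f.coeff γ ≠ 0 → ∃ n : ℕ, γ = c * n) : ∃ x, rho k c hc x = f := by
  refine ⟨PowerSeries.mk fun n => f.coeff (c * n), ?_⟩
  ext γ
  by_cases hγ : ∃ n : ℕ, γ = c * n
  · obtain ⟨n, rfl⟩ := hγ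
    rw [rho_coeff, PowerSeries.coeff_mk]
  · rw [not_not.1 fun h' => hγ (h γ h'), not_not.1 fun h' => hγ (rho_coeff_ne c hc _ γ h')]

theorem tschirn {k : Type*} [Field k] [CharZero k] (P : k[X]) (hP : P.Monic)
    (hn : 0 < P.natDegree) :
    (taylor (-(P.coeff (P.natDegree - 1) / P.natDegree)) P).coeff (P.natDegree - 1) = 0 := by
  obtain ⟨n, hn'⟩ : ∃ n, P.natDegree = n + 1 := ⟨P.natDegree - 1, by omega⟩
  have hc1 : P.coeff (n + 1) = 1 := hn' ▸ hP.coeff_natDegree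
  rw [hn', taylor_coeff, eval_eq_sum_range' (n := 2)
    (by have := natDegree_hasseDeriv_le P n; simp only [Nat.add_sub_cancel]; omega)]
  simp only [Nat.add_sub_cancel, Finset.sum_range_succ, Finset.sum_range_zero, hasseDeriv_coeff]
  have : (n : k) + 1 ≠ 0 := by exact_mod_cast Nat.succ_ne_zero n
  rw [add_comm 1 n, hc1]
  simp
  field_simp
  ring

theorem splits_em {k : Type*} [Field k] [IsAlgClosed k] [CharZero k] (n : ℕ) :
    ∀ (c : ℚ) (hc : 0 < c) (P : (HahnSeries ℤ k)[X]), P.Monic → P.natDegree = n →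
      (P.map (em k c hc)).Splits := by
  induction n using Nat.strong_induction_on with
  | _ n ih =>
  intro c hc P hP hPn
  by_cases hn1 : n ≤ 1
  · exact Splits.of_natDegree_le_one (by rw [hP.natDegree_map]; omega)
  have hchar : CharZero (HahnSeries ℤ k) :=
    charZero_of_injective_ringHom (HahnSeries.C_injective (Γ := ℤ) (R := k))
  -- reduce to vanishing second coefficient
  suffices key : ∀ P : (HahnSeries ℤ k)[X], P.Monic → P.natDegree = n → P.coeff (n - 1) = 0 →
      (P.map (em k c hc)).Splits by
    set b := (-(P.coeff (P.natDegree - 1) / P.natDegree)) with hb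
    have h1 := key (taylor b P) (by have := hP; simpa [Monic, leadingCoeff_taylor] using this) (by rw [natDegree_taylor, hPn])
      (by have := tschirn P hP (by omega); rw [← hPn]; exact this)
    rw [taylor_apply, map_comp] at h1
    rw [splits_iff_comp_splits_of_natDegree_eq_one (g := (X + Polynomial.C b).map (em k c hc))]
    · exact h1
    · simp
  clear P hP hPn
  intro P hP hPn hP1
  classical
  by_cases hex : ∃ i ∈ Finset.range n, P.coeff i ≠ 0
  swap
  · push Not at hex
    have : P = X ^ n := by
      ext1 i
      rw [coeff_X_pow]
      split_ifs with h
      · rw [h, ← hPn, hP.coeff_natDegree]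
      · rcases lt_or_gt_of_ne h with h | h
        · exact hex i (Finset.mem_range.2 h)
        · exact coeff_eq_zero_of_natDegree_lt (by omega)
    rw [this]
    simp
  obtain ⟨i0, hi0, hmin⟩ := Finset.exists_min_image
    ((Finset.range n).filter fun i => P.coeff i ≠ 0)
    (fun i => ((P.coeff i).order : ℚ) / ((n : ℚ) - i))
    (by obtain ⟨i, hi, hi'⟩ := hex; exact ⟨i, Finset.mem_filter.2 ⟨hi, hi'⟩⟩)
  simp only [Finset.mem_filter, Finset.mem_range] at hi0 hmin
  obtain ⟨hi0n, hi0⟩ := hi0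
  set r : ℤ := (P.coeff i0).order with hr
  set s : ℕ := n - i0 with hs
  have hs0 : (0 : ℚ) < s := by exact_mod_cast (by omega : 0 < s)
  have hsq : (s : ℚ) = (n : ℚ) - i0 := by rw [hs]; push_cast [hi0n.le]; ring
  set c' : ℚ := c / s with hc'
  have hc'0 : 0 < c' := div_pos hc hs0
  have hcc : c = c' * s := by rw [hc']; field_simp
  set τ : HahnSeries ℚ k := HahnSeries.single (-(c' * r)) 1 with hτ
  have hτ0 : τ ≠ 0 := by rw [hτ]; simp
  set q := (P.map (em k c hc)).scaleRoots τ with hq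
  have hqm : q.Monic := (monic_scaleRoots_iff _).2 (hP.map _)
  have hqn : q.natDegree = n := by rw [hq, natDegree_scaleRoots, hP.natDegree_map, hPn]
  have hqc : ∀ i γ, (q.coeff i).coeff γ =
      (em k c hc (P.coeff i)).coeff (γ + c' * r * ((n - i : ℕ) : ℚ)) := by
    intro i γ
    rw [hq, coeff_scaleRoots, coeff_map, hP.natDegree_map, hPn, hτ, HahnSeries.single_pow,
      HahnSeries.coeff_mul_single, one_pow, mul_one]
    congr 1
    simp
    ring
  have hqmem : q ∈ lifts (rho k c' hc'0) := by
    rw [lifts_iff_coeff_lifts]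
    intro i
    refine exists_rho c' hc'0 _ fun γ hγ => ?_
    by_cases hin : n < i
    · rw [coeff_eq_zero_of_natDegree_lt (by omega)] at hγ
      simp at hγ
    rcases (not_lt.1 hin).eq_or_lt with rfl | hlt
    · rw [← hqn, hqm.coeff_natDegree] at hγ
      refine ⟨0, ?_⟩
      rw [HahnSeries.coeff_one] at hγ
      simpa using hγ
    rw [hqc] at hγ
    obtain ⟨z, hz, hz'⟩ := em_coeff_ne c hc _ _ hγ
    have hPi : P.coeff i ≠ 0 := by rintro h; rw [h] at hz'; simp at hz'
    have h1 := hmin i ⟨hlt, hPi⟩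
    have h2 : (P.coeff i).order ≤ z := HahnSeries.order_le_of_coeff_ne_zero hz'
    have hni : (0 : ℚ) < (n : ℚ) - i := by
      have : (i : ℚ) < n := by exact_mod_cast hlt
      linarith
    rw [← hsq, div_le_div_iff₀ hs0 hni] at h1
    have h3 : r * ((n - i : ℕ) : ℤ) ≤ z * s := by
      have h4 : (r : ℚ) * ((n : ℚ) - i) ≤ z * s := by
        have h5 : ((P.coeff i).order : ℚ) ≤ z := by exact_mod_cast h2
        nlinarith
      have h6 : (((n - i : ℕ) : ℤ) : ℚ) = (n : ℚ) - i := by push_cast [hlt.le]; ring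
      rw [← h6] at h4
      exact_mod_cast h4
    obtain ⟨m, hm⟩ := Int.eq_ofNat_of_zero_le (sub_nonneg.2 h3)
    refine ⟨m, ?_⟩
    have hm' : (z : ℚ) * s - r * ((n - i : ℕ) : ℚ) = m := by exact_mod_cast hm
    rw [← hm']
    rw [hcc] at hz
    linear_combination hz
  obtain ⟨Q, hQ, hQn, hQm⟩ := lifts_and_natDegree_eq_and_monic hqmem hqm
  set Q0 := Q.map PowerSeries.constantCoeff with hQ0
  have hQ0m : Q0.Monic := hQm.map _
  have hQ0n : Q0.natDegree = n := by rw [hQ0, hQm.natDegree_map, hQn, hqn]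
  have hQ0c : ∀ i, Q0.coeff i = (q.coeff i).coeff 0 := by
    intro i
    have := rho_coeff c' hc'0 (Q.coeff i) 0
    rw [hQ0, coeff_map, ← hQ, coeff_map]
    simpa using this.symm
  have hQ01 : Q0.coeff (n - 1) = 0 := by rw [hQ0c, hqc, hP1]; simp
  have hQ0i : Q0.coeff i0 ≠ 0 := by
    rw [hQ0c, hqc, show (0 : ℚ) + c' * r * ((n - i0 : ℕ) : ℚ) = c * r by
      rw [← hs, hcc]; ring, em_coeff, hr]
    exact fun h => hi0 (HahnSeries.coeff_order_eq_zero.1 h)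
  obtain ⟨z, hz⟩ := IsAlgClosed.exists_root Q0 (by
    rw [degree_eq_natDegree hQ0m.ne_zero, hQ0n]; exact_mod_cast (by omega))
  obtain ⟨h0, hh0, hh0'⟩ := exists_eq_pow_rootMultiplicity_mul_and_not_dvd Q0 hQ0m.ne_zero z
  set m := rootMultiplicity z Q0 with hm
  have hm0 : 0 < m := (rootMultiplicity_pos hQ0m.ne_zero).2 hz
  have hg0m : ((X - Polynomial.C z) ^ m).Monic := (monic_X_sub_C z).pow m
  have hh0m : h0.Monic := hg0m.of_mul_monic_left (hh0 ▸ hQ0m)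
  have hdeg : n = m + h0.natDegree := by
    rw [← hQ0n, hh0, hg0m.natDegree_mul hh0m, natDegree_pow, natDegree_X_sub_C, mul_one]
  have hh0n : 0 < h0.natDegree := by
    by_contra hcon
    have h1 : h0 = 1 := hh0m.natDegree_eq_zero.1 (by omega)
    have hmn : m = n := by rw [h1] at hdeg; simpa using hdeg.symm
    rw [h1, mul_one, hmn] at hh0
    have h2 : Q0.nextCoeff = 0 := by
      rw [nextCoeff_of_natDegree_pos (by omega), hQ0n, hQ01]
    rw [hh0, (monic_X_sub_C z).nextCoeff_pow, nextCoeff_X_sub_C] at h2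
    have hnk : (n : k) ≠ 0 := by exact_mod_cast (by omega : n ≠ 0)
    have hz0 : z = 0 := by simpa [hnk] using h2
    rw [hh0, hz0, C_0, sub_zero, coeff_X_pow, if_neg (by omega)] at hQ0i
    exact hQ0i rfl
  have hcop : IsCoprime ((X - Polynomial.C z) ^ m) h0 :=
    IsCoprime.pow_left (((irreducible_X_sub_C z).coprime_iff_not_dvd).2 hh0')
  obtain ⟨g, h, hgh, hgm, hhm, hgd, hhd⟩ := hensel_monic hg0m hh0m hcop Q hQm hh0
  rw [natDegree_pow, natDegree_X_sub_C, mul_one] at hgd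
  have hfac : ∀ u : (PowerSeries k)[X], u.Monic → u.natDegree < n →
      (u.map (rho k c' hc'0)).Splits := by
    intro u hu hun
    rw [rho, ← Polynomial.map_map]
    exact ih _ hun c' hc'0 _ (hu.map _) (hu.natDegree_map _)
  have hqs : q.Splits := by
    rw [← hQ, hgh, Polynomial.map_mul]
    exact (hfac g hgm (by omega)).mul (hfac h hhm (by omega))
  have := hqs.scaleRoots τ⁻¹
  have e : P.map (em k c hc) = q.scaleRoots τ⁻¹ := by
    ext1 i
    rw [coeff_scaleRoots, hqn, hq, coeff_scaleRoots, hP.natDegree_map, hPn, mul_assoc, ← mul_pow,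
      mul_inv_cancel₀ hτ0, one_pow, mul_one]
  rw [e]
  exact this


/-- additive maps satisfying the Leibniz rule along `φ` -/
def IsDer {A M : Type*} [CommRing A] [CommRing M] (φ : A →+* M) (d : A → M) : Prop :=
  (∀ a b, d (a + b) = d a + d b) ∧ ∀ a b, d (a * b) = φ a * d b + d a * φ b

theorem IsDer.zero {A M : Type*} [CommRing A] [CommRing M] {φ : A →+* M} {d : A → M}
    (h : IsDer φ d) : d 0 = 0 := by
  have := h.1 0 0
  simpa using this

theorem IsDer.one {A M : Type*} [CommRing A] [CommRing M] {φ : A →+* M} {d : A → M}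
    (h : IsDer φ d) : d 1 = 0 := by
  have := h.2 1 1
  simpa using this

theorem IsDer.sum {A M : Type*} [CommRing A] [CommRing M] {φ : A →+* M} {d : A → M}
    (h : IsDer φ d) {ι : Type*} (s : Finset ι) (f : ι → A) :
    d (∑ i ∈ s, f i) = ∑ i ∈ s, d (f i) :=
  map_sum (⟨⟨d, h.zero⟩, h.1⟩ : A →+ M) f s

theorem IsDer.pow {A M : Type*} [CommRing A] [CommRing M] {φ : A →+* M} {d : A → M}
    (h : IsDer φ d) (a : A) (n : ℕ) : d (a ^ n) = n * φ a ^ (n - 1) * d a := by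
  induction n with
  | zero => simp [h.one]
  | succ n ih =>
    rw [pow_succ, h.2, ih, map_pow]
    rcases n with _ | n
    · simp
    · simp only [Nat.add_sub_cancel]; push_cast; ring

/-- chain rule for polynomials with constant coefficients -/
theorem IsDer.eval₂ {R A M : Type*} [CommRing R] [CommRing A] [CommRing M] {φ : A →+* M}
    {d : A → M} (h : IsDer φ d) (j : R →+* A) (hj : ∀ r, d (j r) = 0) (p : R[X]) (a : A) :
    d (p.eval₂ j a) = φ (p.derivative.eval₂ j a) * d a := by
  induction p using Polynomial.induction_on' with
  | add p q hp hq => rw [eval₂_add, h.1, hp, hq, derivative_add, eval₂_add, map_add]; ring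
  | monomial n r =>
    rw [eval₂_monomial, h.2, hj, h.pow, derivative_monomial, eval₂_monomial]
    simp
    ring

theorem KDeriv_C (c : C) : KDeriv C (algebraMap C (RatFunc C) c) = 0 := by
  have : algebraMap C (RatFunc C) c = RatFunc.C c := rfl
  rw [this, KDeriv, RatFunc.num_C, RatFunc.denom_C]
  simp

theorem KDeriv_compat {M : Type*} [Field M] (φ : RatFunc C →+* M) (δ : M → M)
    (hδ : IsDer (RingHom.id M) δ)
    (h : ∀ p : C[X], δ (φ (algebraMap _ _ p)) = φ (algebraMap _ _ (derivative p)))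
    (r : RatFunc C) : φ (KDeriv C r) = δ (φ r) := by
  set n := algebraMap C[X] (RatFunc C) r.num with hn
  set e := algebraMap C[X] (RatFunc C) r.denom with he
  have he0 : e ≠ 0 := RatFunc.algebraMap_ne_zero r.denom_ne_zero
  have hr : r * e = n := by
    conv_lhs => rw [← RatFunc.num_div_denom r]
    rw [← hn, ← he]; field_simp
  have h1 : δ (φ r * φ e) = φ (algebraMap _ _ (derivative r.num)) := by
    rw [← map_mul, hr, h]
  rw [hδ.2, h] at h1
  simp only [RingHom.id_apply] at h1
  have he' : φ e ≠ 0 := by simpa using he0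
  rw [KDeriv, ← hn, ← he, map_div₀, div_eq_iff (by simpa using he0), map_sub, map_mul, map_mul,
    map_pow, ← h1, ← hr, map_mul]
  ring

/-- `t d/dt` -/
def theta (f : HahnSeries ℚ C) : HahnSeries ℚ C where
  coeff := fun γ => γ • f.coeff γ
  isPWO_support' := f.isPWO_support.mono (by
    intro γ hγ
    simp only [Function.mem_support, ne_eq] at hγ ⊢
    intro hc
    exact hγ (by rw [hc, smul_zero]))

theorem theta_support (f : HahnSeries ℚ C) : (theta C f).support ⊆ f.support := by
  intro γ hγ hc
  exact hγ (by simp only [theta]; rw [hc, smul_zero])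

theorem theta_mul (f g : HahnSeries ℚ C) :
    theta C (f * g) = f * theta C g + theta C f * g := by
  ext γ
  rw [HahnSeries.coeff_add, HahnSeries.coeff_mul_left' f.isPWO_support (theta_support C f),
    HahnSeries.coeff_mul_right' g.isPWO_support (theta_support C g), ← Finset.sum_add_distrib]
  simp only [theta]
  rw [HahnSeries.coeff_mul, Finset.smul_sum]
  refine Finset.sum_congr rfl fun ij hij => ?_
  have : ij.1 + ij.2 = γ := (Finset.mem_antidiagonal.1 hij).2.2
  rw [← this, add_smul, mul_smul_comm, smul_mul_assoc, add_comm]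

theorem hderiv_eq (f : HahnSeries ℚ C) :
    hderiv C f = HahnSeries.single (-1 : ℚ) (1 : C) * theta C f := by
  ext γ
  rw [HahnSeries.coeff_single_mul, one_mul]
  have : γ = (OrderIso.addRight (-1 : ℚ)).toOrderEmbedding (γ - -1) := by simp
  conv_lhs => rw [this]
  rw [hderiv, HahnSeries.embDomain_coeff]
  rfl

theorem hderiv_isDer : IsDer (RingHom.id _) (hderiv C) := by
  refine ⟨fun a b => ?_, fun a b => ?_⟩
  · simp only [hderiv_eq]
    rw [← mul_add]
    congr 1
    ext γ
    simp [theta]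
  · simp only [hderiv_eq, theta_mul, RingHom.id_apply]
    ring

theorem dinf_isDer : IsDer (RingHom.id _) (dinf C) := by
  refine ⟨fun a b => ?_, fun a b => ?_⟩
  · simp only [dinf, (hderiv_isDer C).1]
    ring
  · simp only [dinf, (hderiv_isDer C).2, RingHom.id_apply]
    ring

theorem hderiv_single (γ : ℚ) (c : C) :
    hderiv C (HahnSeries.single γ c) = HahnSeries.single (γ - 1) (γ • c) := by
  rw [hderiv_eq]
  have : theta C (HahnSeries.single γ c) = HahnSeries.single γ (γ • c) := by
    ext x
    by_cases hx : x = γ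
    · subst hx; simp [theta]
    · simp [theta, HahnSeries.coeff_single_of_ne hx]
  rw [this, HahnSeries.single_mul_single, one_mul]
  congr 1
  ring_nf

theorem hderiv_C (c : C) : hderiv C (HahnSeries.C c) = 0 := by
  change hderiv C (HahnSeries.single 0 c) = 0
  rw [hderiv_single]; simp

theorem dinf_C (c : C) : dinf C (HahnSeries.C c) = 0 := by
  rw [dinf, hderiv_C]; simp

/-- Local expansions: for `y` a Laurent series with `δ y = 1` there is an expansion `x ↦ y`. -/
theorem exists_expansion (δ : HahnSeries ℚ C → HahnSeries ℚ C) (hδ : IsDer (RingHom.id _) δ)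
    (hδC : ∀ c, δ (HahnSeries.C c) = 0) (y : HahnSeries ℤ C)
    (hy : δ (em C 1 one_pos y) = 1) :
    ∃ ι : RatFunc C →+* HahnSeries ℚ C, IsExpansion C δ ι ∧
      (∀ p : C[X], ι (algebraMap _ _ p) = p.eval₂ HahnSeries.C (em C 1 one_pos y)) ∧
      ∀ p : (RatFunc C)[X], p.Monic → (p.map ι).Splits := by
  have hemC : ∀ c, em C 1 one_pos (HahnSeries.C c) = HahnSeries.C c :=
    fun c => HahnSeries.embDomainRingHom_C
  have hev : ∀ p : C[X], em C 1 one_pos (p.eval₂ HahnSeries.C y) =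
      p.eval₂ HahnSeries.C (em C 1 one_pos y) := by
    intro p
    rw [Polynomial.hom_eval₂]
    congr 1
    ext1 c
    exact hemC c
  have hder : ∀ p : C[X], δ (p.eval₂ HahnSeries.C (em C 1 one_pos y)) =
      (derivative p).eval₂ HahnSeries.C (em C 1 one_pos y) := by
    intro p
    rw [hδ.eval₂ _ hδC, hy, mul_one, RingHom.id_apply]
  have hinj : ∀ n, ∀ p : C[X], p.natDegree ≤ n →
      p.eval₂ HahnSeries.C (em C 1 one_pos y) = 0 → p = 0 := by
    intro n
    induction n with
    | zero =>
      intro p hp h0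
      rw [eq_C_of_natDegree_le_zero hp] at h0 ⊢
      rw [eval₂_C] at h0
      rw [(map_eq_zero _).1 h0, C_0]
    | succ n ih =>
      intro p hp h0
      have h1 := ih (derivative p) ((natDegree_derivative_le p).trans (by omega))
        (by rw [← hder, h0, hδ.zero])
      have h2 := derivative_eq_zero.1 h1
      rw [eq_C_of_natDegree_eq_zero h2] at h0 ⊢
      rw [eval₂_C] at h0
      rw [(map_eq_zero _).1 h0, C_0]
  have hinj' : Function.Injective (eval₂RingHom (HahnSeries.C (Γ := ℤ) (R := C)) y) := by
    rw [injective_iff_map_eq_zero]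
    intro p hp
    refine hinj _ p le_rfl ?_
    rw [← hev]
    rw [coe_eval₂RingHom] at hp
    rw [hp, map_zero]
  let ιL : RatFunc C →+* HahnSeries ℤ C := IsFractionRing.lift hinj'
  have hι : ∀ p : C[X], ((em C 1 one_pos).comp ιL) (algebraMap _ _ p) =
      p.eval₂ HahnSeries.C (em C 1 one_pos y) := by
    intro p
    rw [RingHom.comp_apply, IsFractionRing.lift_algebraMap, coe_eval₂RingHom, hev]
  refine ⟨(em C 1 one_pos).comp ιL, ?_, hι, ?_⟩
  · intro r
    refine KDeriv_compat C _ δ hδ (fun p => ?_) r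
    rw [hι, hι, hder]
  · intro p hp
    rw [← Polynomial.map_map]
    exact splits_em _ 1 one_pos _ (hp.map _) rfl

theorem exists_expansion_fin (ξ : C) :
    ∃ ι : RatFunc C →+* HahnSeries ℚ C, IsExpansion C (hderiv C) ι ∧
      (∀ p : C[X], ι (algebraMap _ _ p) =
        p.eval₂ HahnSeries.C (HahnSeries.single 1 1 + HahnSeries.C ξ)) ∧
      ∀ p : (RatFunc C)[X], p.Monic → (p.map ι).Splits := by
  have hy : em C 1 one_pos (HahnSeries.single 1 1 + HahnSeries.C ξ) =
      HahnSeries.single 1 1 + HahnSeries.C ξ := by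
    rw [map_add, em_single]
    congr 1
    · simp
    · exact HahnSeries.embDomainRingHom_C
  have := exists_expansion C (hderiv C) (hderiv_isDer C) (hderiv_C C)
    (HahnSeries.single 1 1 + HahnSeries.C ξ)
    (by rw [hy, (hderiv_isDer C).1, hderiv_C, hderiv_single]; simp)
  rwa [hy] at this

theorem exists_expansion_inf :
    ∃ ι : RatFunc C →+* HahnSeries ℚ C, IsExpansion C (dinf C) ι ∧
      (∀ p : C[X], ι (algebraMap _ _ p) =
        p.eval₂ HahnSeries.C (HahnSeries.single (-1) 1)) ∧
      ∀ p : (RatFunc C)[X], p.Monic → (p.map ι).Splits := by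
  have hy : em C 1 one_pos (HahnSeries.single (-1) 1) = HahnSeries.single (-1) 1 := by
    rw [em_single]
    simp
  have := exists_expansion C (dinf C) (dinf_isDer C) (dinf_C C)
    (HahnSeries.single (-1) 1)
    (by
      rw [hy, dinf, hderiv_single, HahnSeries.single_mul_single]
      norm_num)
  rwa [hy] at this


/-- the ring of integral series -/
def intSub : Subring (HahnSeries ℚ C) where
  carrier := {f | IntegralSeries C f}
  zero_mem' := fun γ _ => by simp
  one_mem' := fun γ hγ => by
    rw [HahnSeries.coeff_one, if_neg hγ.ne]
  add_mem' := fun {a b} ha hb γ hγ => by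
    rw [HahnSeries.coeff_add, ha γ hγ, hb γ hγ, add_zero]
  neg_mem' := fun {a} ha γ hγ => by
    rw [HahnSeries.coeff_neg, ha γ hγ, neg_zero]
  mul_mem' := fun {a b} ha hb γ hγ => by
    rw [HahnSeries.coeff_mul]
    refine Finset.sum_eq_zero fun ij hij => ?_
    have : ij.1 + ij.2 = γ := (Finset.mem_antidiagonal.1 hij).2.2
    rcases lt_or_ge ij.1 0 with h | h
    · rw [ha _ h, zero_mul]
    · rw [hb _ (by linarith), mul_zero]

theorem mem_intSub {f : HahnSeries ℚ C} : f ∈ intSub C ↔ IntegralSeries C f := Iff.rfl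

theorem single_mem_intSub (γ : ℚ) (hγ : 0 ≤ γ) (c : C) : HahnSeries.single γ c ∈ intSub C := by
  intro γ' h
  exact HahnSeries.coeff_single_of_ne (by linarith [h] : γ' < γ).ne

theorem coeff_zero_mul {f g : HahnSeries ℚ C} (hf : f ∈ intSub C) (hg : g ∈ intSub C) :
    (f * g).coeff 0 = f.coeff 0 * g.coeff 0 := by
  have key : ∀ u : HahnSeries ℚ C, u ∈ intSub C → ∀ γ, u.coeff γ ≠ 0 → 0 ≤ γ := by
    intro u hu γ h
    by_contra h'
    exact h (hu γ (not_le.1 h'))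
  rw [HahnSeries.coeff_mul]
  by_cases h : f.coeff 0 = 0 ∨ g.coeff 0 = 0
  · have : f.coeff 0 * g.coeff 0 = 0 := by rcases h with h | h <;> simp [h]
    rw [this]
    refine Finset.sum_eq_zero fun ij hij => ?_
    obtain ⟨h1, h2, h3⟩ := Finset.mem_antidiagonal.1 hij
    have h1' := key f hf _ h1
    have h2' := key g hg _ h2
    have e1 : ij.1 = 0 := by linarith
    have e2 : ij.2 = 0 := by linarith
    rw [e1, e2, this]
  · push Not at h
    rw [Finset.sum_eq_single (0, 0)]
    · intro ij hij hne
      obtain ⟨h1, h2, h3⟩ := Finset.mem_antidiagonal.1 hij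
      have h1' := key f hf _ h1
      have h2' := key g hg _ h2
      exact absurd (Prod.ext (by simp; linarith) (by simp; linarith)) hne
    · intro h'
      exact absurd (Finset.mem_antidiagonal.2 ⟨h.1, h.2, by simp⟩) h'

/-- a rational function without poles is constant -/
theorem ratfunc_const (r : RatFunc C)
    (h1 : ∀ ξ : C, ∀ ι : RatFunc C →+* HahnSeries ℚ C, (∀ p : C[X], ι (algebraMap _ _ p) =
        p.eval₂ HahnSeries.C (HahnSeries.single 1 1 + HahnSeries.C ξ)) →
        IsExpansion C (hderiv C) ι → (∀ p : (RatFunc C)[X], p.Monic → (p.map ι).Splits) →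
        ι r ∈ intSub C)
    (h2 : ∀ ι : RatFunc C →+* HahnSeries ℚ C, (∀ p : C[X], ι (algebraMap _ _ p) =
        p.eval₂ HahnSeries.C (HahnSeries.single (-1) 1)) →
        IsExpansion C (dinf C) ι → (∀ p : (RatFunc C)[X], p.Monic → (p.map ι).Splits) →
        ι r ∈ intSub C) : ∃ c : C, algebraMap C (RatFunc C) c = r := by
  have hd : r.denom.natDegree = 0 := by
    by_contra hne
    obtain ⟨ξ, hξ⟩ := IsAlgClosed.exists_root r.denom (by
      rw [degree_eq_natDegree r.denom_ne_zero]; exact_mod_cast hne)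
    have hnum : r.num.eval ξ ≠ 0 := by
      intro h0
      obtain ⟨u, v, huv⟩ := r.isCoprime_num_denom
      have := congrArg (Polynomial.eval ξ) huv
      rw [eval_add, eval_mul, eval_mul, h0, hξ.eq_zero] at this
      simp at this
    obtain ⟨ι, hι, hιp, hs⟩ := exists_expansion_fin C ξ
    have hr := h1 ξ ι hιp hι hs
    have hy : (HahnSeries.single 1 1 + HahnSeries.C ξ : HahnSeries ℚ C) ∈ intSub C :=
      add_mem (single_mem_intSub C 1 zero_le_one 1) (single_mem_intSub C 0 le_rfl ξ)
    have hval : ∀ p : C[X], p.eval₂ HahnSeries.C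
        (HahnSeries.single 1 1 + HahnSeries.C ξ : HahnSeries ℚ C) ∈ intSub C ∧
        (p.eval₂ HahnSeries.C
        (HahnSeries.single 1 1 + HahnSeries.C ξ : HahnSeries ℚ C)).coeff 0 = p.eval ξ := by
      intro p
      induction p using Polynomial.induction_on with
      | C a => 
        rw [eval₂_C, eval_C]
        exact ⟨single_mem_intSub C 0 le_rfl a, HahnSeries.coeff_single_same _ _⟩
      | add p q hp hq =>
        rw [eval₂_add, eval_add, HahnSeries.coeff_add, hp.2, hq.2]
        exact ⟨add_mem hp.1 hq.1, rfl⟩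
      | monomial n a ih =>
        rw [pow_succ, ← mul_assoc, eval₂_mul, eval₂_X, eval_mul, eval_X]
        refine ⟨mul_mem ih.1 hy, ?_⟩
        rw [coeff_zero_mul C ih.1 hy, ih.2]
        congr 1
        rw [HahnSeries.coeff_add, HahnSeries.coeff_single_of_ne (by norm_num), zero_add]
        exact HahnSeries.coeff_single_same _ _
    have hmul : ι r * ι (algebraMap _ _ r.denom) = ι (algebraMap _ _ r.num) := by
      rw [← map_mul]
      congr 1
      conv_lhs => rw [← RatFunc.num_div_denom r]
      rw [RatFunc.num_div_denom]
      exact (div_eq_iff (RatFunc.algebraMap_ne_zero r.denom_ne_zero)).1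
        (RatFunc.num_div_denom r) |>.symm
    have := congrArg (fun f => HahnSeries.coeff f 0) hmul
    simp only [hιp] at this
    rw [coeff_zero_mul C hr (hval _).1, (hval _).2, (hval _).2, hξ.eq_zero, mul_zero] at this
    exact hnum this.symm
  have hd1 : r.denom = 1 := (RatFunc.monic_denom r).natDegree_eq_zero.1 hd
  have hrn : r = algebraMap _ _ r.num := by
    conv_lhs => rw [← RatFunc.num_div_denom r, hd1, map_one, div_one]
  obtain ⟨ι, hι, hιp, hs⟩ := exists_expansion_inf C
  have hr := h2 ι hιp hι hs
  have hn : r.num.natDegree = 0 := by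
    by_contra hne
    have hpos : 0 < r.num.natDegree := Nat.pos_of_ne_zero hne
    have h0 := hr (-(r.num.natDegree : ℚ)) (by simpa using hpos)
    rw [hrn, hιp, RatFunc.num_algebraMap, eval₂_eq_sum_range, HahnSeries.coeff_sum,
      Finset.sum_range_succ, Finset.sum_eq_zero, zero_add] at h0
    · rw [HahnSeries.single_pow, HahnSeries.C_mul_eq_smul, HahnSeries.coeff_smul] at h0
      simp at h0
      rw [h0] at hpos
      simp at hpos
    · intro i hi
      rw [HahnSeries.single_pow, HahnSeries.C_mul_eq_smul, HahnSeries.coeff_smul,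
        HahnSeries.coeff_single_of_ne, smul_zero]
      have := Finset.mem_range.1 hi
      have h' : (i : ℚ) < r.num.natDegree := by exact_mod_cast this
      simp only [nsmul_eq_mul, mul_neg, mul_one, ne_eq, neg_inj]
      exact h'.ne'
  refine ⟨r.num.coeff 0, ?_⟩
  conv_rhs => rw [hrn, eq_C_of_natDegree_eq_zero hn]
  rfl

theorem der_transfer (F : DiffExt C) (halg : Algebra.IsAlgebraic (RatFunc C) F.carrier)
    (δ : HahnSeries ℚ C → HahnSeries ℚ C) (hδ : IsDer (RingHom.id _) δ)
    (ι : RatFunc C →+* HahnSeries ℚ C) (hι : IsExpansion C δ ι)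
    (φ : F.carrier →+* HahnSeries ℚ C)
    (hφ : ∀ r, φ (algebraMap (RatFunc C) F.carrier r) = ι r) (a : F.carrier) :
    φ (F.δ a) = δ (φ a) := by
  have hE : IsDer φ (fun a => φ (F.δ a) - δ (φ a)) := by
    refine ⟨fun a b => ?_, fun a b => ?_⟩
    · simp only [F.δ_add, map_add, hδ.1]; ring
    · simp only [F.δ_mul, map_add, map_mul, hδ.2, RingHom.id_apply]; ring
  have hint : IsIntegral (RatFunc C) a := (halg.isAlgebraic a).isIntegral
  have h1 := hE.eval₂ (algebraMap (RatFunc C) F.carrier)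
    (fun r => by simp only [F.δ_algebraMap, hφ, hι r, sub_self]) (minpoly (RatFunc C) a) a
  have hsep := (minpoly.irreducible hint).separable
  have h2 := hsep.aeval_derivative_ne_zero (minpoly.aeval _ a)
  have h3 := minpoly.aeval (RatFunc C) a
  rw [aeval_def] at h2 h3
  rw [h3] at h1
  have h4 := hE.zero
  rw [h4] at h1
  have h5 := (mul_eq_zero.1 h1.symm).resolve_left (by simpa using h2)
  exact sub_eq_zero.1 h5

theorem apply_transfer (F : DiffExt C) 
    (δ : HahnSeries ℚ C → HahnSeries ℚ C) (ι : RatFunc C →+* HahnSeries ℚ C)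
    (φ : F.carrier →+* HahnSeries ℚ C)
    (hφ : ∀ r, φ (algebraMap (RatFunc C) F.carrier r) = ι r)
    (hd : ∀ a, φ (F.δ a) = δ (φ a)) (P : DOp C) (f : F.carrier) :
    φ (F.apply C P f) = localApply C δ ι P (φ f) := by
  have hit : ∀ n, φ (F.δ^[n] f) = δ^[n] (φ f) := by
    intro n
    induction n with
    | zero => rfl
    | succ n ih => rw [Function.iterate_succ_apply', Function.iterate_succ_apply', hd, ih]
  rw [DiffExt.apply, localApply, Polynomial.sum, Polynomial.sum, map_sum]
  refine Finset.sum_congr rfl fun i _ => ?_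
  rw [map_mul, hφ, hit]

theorem exists_const (F : DiffExt C) (halg : Algebra.IsAlgebraic (RatFunc C) F.carrier)
    (g : F.carrier)
    (h : ∀ δ ∈ ({hderiv C, dinf C} : Set (HahnSeries ℚ C → HahnSeries ℚ C)),
      ∀ ι : RatFunc C →+* HahnSeries ℚ C, IsExpansion C δ ι →
      ∀ φ : F.carrier →+* HahnSeries ℚ C,
        (∀ r, φ (algebraMap (RatFunc C) F.carrier r) = ι r) → φ g ∈ intSub C) :
    ∃ c : C, algebraMap C F.carrier c = g := by
  have hint : ∀ a : F.carrier, IsIntegral (RatFunc C) a := fun a => (halg.isAlgebraic a).isIntegral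
  set m := minpoly (RatFunc C) g with hm
  have hmm : m.Monic := minpoly.monic (hint g)
  have hcoef : ∀ δ ∈ ({hderiv C, dinf C} : Set (HahnSeries ℚ C → HahnSeries ℚ C)),
      ∀ ι : RatFunc C →+* HahnSeries ℚ C, IsExpansion C δ ι →
      (∀ p : (RatFunc C)[X], p.Monic → (p.map ι).Splits) → ∀ i, ι (m.coeff i) ∈ intSub C := by
    intro δ hδ ι hι hs i
    have hroot : ∀ y ∈ (m.map ι).roots, y ∈ intSub C := by
      intro y hy
      let _ : Algebra (RatFunc C) (HahnSeries ℚ C) := ι.toAlgebra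
      have hy' : aeval y (minpoly (RatFunc C) g) = 0 := by
        rw [aeval_def, ← eval_map]
        exact (mem_roots'.1 hy).2
      obtain ⟨φ, hφ⟩ := IntermediateField.exists_algHom_of_splits_of_aeval
        (F := RatFunc C) (E := F.carrier) (K := HahnSeries ℚ C)
        (fun s => ⟨hint s, hs _ (minpoly.monic (hint s))⟩) hy'
      rw [← hφ]
      exact h δ hδ ι hι φ.toRingHom (fun r => φ.commutes r)
    have hprod := (hs m hmm).eq_prod_roots_of_monic (hmm.map ι)
    have hl : m.map ι ∈ lifts (intSub C).subtype := by
      rw [hprod]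
      refine multiset_prod_mem _ fun p hp => ?_
      obtain ⟨y, hy, rfl⟩ := Multiset.mem_map.1 hp
      rw [lifts_iff_liftsRing]
      refine sub_mem ?_ ?_
      · exact (lifts_iff_liftsRing _ _).1 (X_mem_lifts _)
      · exact (lifts_iff_liftsRing _ _).1 (C_mem_lifts _ (⟨y, hroot y hy⟩ : intSub C))
    obtain ⟨⟨z, hz⟩, hz'⟩ := (lifts_iff_coeff_lifts _).1 hl i
    rw [coeff_map] at hz'
    rw [← hz']
    exact hz
  have hC : ∀ i, ∃ c : C, algebraMap C (RatFunc C) c = m.coeff i := fun i =>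
    ratfunc_const C _
      (fun ξ ι _ hι hs => hcoef _ (by simp) ι hι hs i)
      (fun ι _ hι hs => hcoef _ (by simp) ι hι hs i)
  obtain ⟨m0, hm0, hm0d, hm0m⟩ := lifts_and_natDegree_eq_and_monic
    ((lifts_iff_coeff_lifts (f := algebraMap C (RatFunc C)) m).2 hC) hmm
  obtain ⟨c, hc⟩ := IsAlgClosed.exists_root m0 (by
    rw [degree_eq_natDegree hm0m.ne_zero, hm0d]
    exact_mod_cast (minpoly.natDegree_pos (hint g)).ne')
  refine ⟨c, ?_⟩
  rw [IsScalarTower.algebraMap_apply C (RatFunc C) F.carrier]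
  refine minpoly.root (hint g) ?_
  rw [← hm, ← hm0]
  exact hc.map


theorem delta_isDer (F : DiffExt C) : IsDer (RingHom.id F.carrier) F.δ :=
  ⟨F.δ_add, fun a b => F.δ_mul a b⟩

theorem delta_iter_zero (F : DiffExt C) (n : ℕ) : F.δ^[n] 0 = 0 :=
  Function.iterate_fixed (delta_isDer C F).zero n

theorem KDeriv_zero : KDeriv C 0 = 0 := by
  have := KDeriv_C C 0
  rwa [map_zero] at this

theorem apply_add (F : DiffExt C) (P Q : DOp C) (f : F.carrier) :
    F.apply C (P + Q) f = F.apply C P f + F.apply C Q f := by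
  rw [DiffExt.apply, Polynomial.sum_add_index]
  · rfl
  · intro i; simp
  · intro i a b; rw [map_add, add_mul]

theorem apply_zero_op (F : DiffExt C) (f : F.carrier) : F.apply C 0 f = 0 := by
  simp [DiffExt.apply]

theorem apply_sum (F : DiffExt C) {ι : Type*} (s : Finset ι) (P : ι → DOp C) (f : F.carrier) :
    F.apply C (∑ i ∈ s, P i) f = ∑ i ∈ s, F.apply C (P i) f :=
  map_sum (⟨⟨fun P => F.apply C P f, apply_zero_op C F f⟩,
    fun P Q => apply_add C F P Q f⟩ : DOp C →+ F.carrier) P s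

theorem apply_C_mul (F : DiffExt C) (a : RatFunc C) (P : DOp C) (f : F.carrier) :
    F.apply C (Polynomial.C a * P) f = algebraMap _ F.carrier a * F.apply C P f := by
  rw [← smul_eq_C_mul, DiffExt.apply, Polynomial.sum_smul_index]
  · rw [DiffExt.apply, Polynomial.sum, Polynomial.sum, Finset.mul_sum]
    refine Finset.sum_congr rfl fun i _ => ?_
    rw [map_mul, mul_assoc]
  · intro i; simp

theorem apply_X_pow (F : DiffExt C) (i : ℕ) (f : F.carrier) :
    F.apply C (X ^ i) f = F.δ^[i] f := by
  rw [DiffExt.apply, X_pow_eq_monomial, Polynomial.sum_monomial_index] <;> simp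

theorem Dmul_eq (P : DOp C) : Dmul C P =
    ∑ i ∈ P.support, (Polynomial.C (P.coeff i) * X ^ (i + 1)
      + Polynomial.C (KDeriv C (P.coeff i)) * X ^ i) := by
  rw [Dmul, Finset.sum_add_distrib, Polynomial.sum]
  congr 1
  conv_lhs => rw [P.as_sum_support_C_mul_X_pow, Finset.mul_sum]
  refine Finset.sum_congr rfl fun i _ => ?_
  ring

theorem apply_Dmul (F : DiffExt C) (P : DOp C) (f : F.carrier) :
    F.apply C (Dmul C P) f = F.δ (F.apply C P f) := by
  rw [Dmul_eq, apply_sum, DiffExt.apply, Polynomial.sum, (delta_isDer C F).sum]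
  refine Finset.sum_congr rfl fun i _ => ?_
  rw [apply_add, apply_C_mul, apply_C_mul, apply_X_pow, apply_X_pow, F.δ_mul, F.δ_algebraMap,
    Function.iterate_succ_apply']

theorem apply_Dmul_iter (F : DiffExt C) (n : ℕ) (P : DOp C) (f : F.carrier) :
    F.apply C ((Dmul C)^[n] P) f = F.δ^[n] (F.apply C P f) := by
  induction n with
  | zero => rfl
  | succ n ih => rw [Function.iterate_succ_apply', Function.iterate_succ_apply', apply_Dmul, ih]

theorem apply_opMul_zero (F : DiffExt C) (Q L : DOp C) (f : F.carrier)
    (h : F.apply C L f = 0) : F.apply C (opMul C Q L) f = 0 := by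
  rw [opMul, Polynomial.sum, apply_sum]
  refine Finset.sum_eq_zero fun i _ => ?_
  rw [apply_C_mul, apply_Dmul_iter, h, delta_iter_zero, mul_zero]

theorem Dmul_coeff (P : DOp C) (i : ℕ) :
    (Dmul C P).coeff i = (X * P).coeff i + KDeriv C (P.coeff i) := by
  rw [Dmul, coeff_add, Polynomial.sum, finset_sum_coeff]
  congr 1
  simp only [coeff_C_mul_X_pow]
  rw [Finset.sum_ite_eq]
  split_ifs with h
  · rfl
  · rw [notMem_support_iff.1 h, KDeriv_zero]

theorem Dmul_lead (P : DOp C) (hP : P ≠ 0) :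
    (Dmul C P).natDegree = P.natDegree + 1 ∧ (Dmul C P).leadingCoeff = P.leadingCoeff := by
  have hc : (Dmul C P).coeff (P.natDegree + 1) = P.leadingCoeff := by
    rw [Dmul_coeff, coeff_X_mul, coeff_eq_zero_of_natDegree_lt (Nat.lt_succ_self _), KDeriv_zero,
      add_zero]
    rfl
  have hd : (Dmul C P).natDegree = P.natDegree + 1 := by
    refine le_antisymm (natDegree_le_iff_coeff_eq_zero.2 fun N hN => ?_) ?_
    · obtain ⟨N, rfl⟩ : ∃ M, N = M + 1 := ⟨N - 1, by omega⟩
      rw [Dmul_coeff, coeff_X_mul, coeff_eq_zero_of_natDegree_lt (by omega),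
        coeff_eq_zero_of_natDegree_lt (by omega), KDeriv_zero, add_zero]
    · refine le_natDegree_of_ne_zero ?_
      rw [hc]
      exact leadingCoeff_ne_zero.2 hP
  exact ⟨hd, by rw [leadingCoeff, hd, hc]⟩

theorem Dmul_iter_lead (P : DOp C) (hP : P ≠ 0) (n : ℕ) :
    ((Dmul C)^[n] P).natDegree = P.natDegree + n ∧
      ((Dmul C)^[n] P).leadingCoeff = P.leadingCoeff := by
  induction n with
  | zero => exact ⟨rfl, rfl⟩
  | succ n ih =>
    have h0 : (Dmul C)^[n] P ≠ 0 := by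
      rw [← leadingCoeff_ne_zero, ih.2]; exact leadingCoeff_ne_zero.2 hP
    have := Dmul_lead C _ h0
    rw [Function.iterate_succ_apply', this.1, this.2, ih.1, ih.2]
    exact ⟨by ring, rfl⟩

theorem opMul_add (P Q L : DOp C) : opMul C (P + Q) L = opMul C P L + opMul C Q L := by
  rw [opMul, Polynomial.sum_add_index]
  · rfl
  · intro i; simp
  · intro i a b; rw [map_add, add_mul]

theorem opMul_monomial (i : ℕ) (a : RatFunc C) (L : DOp C) :
    opMul C (monomial i a) L = Polynomial.C a * (Dmul C)^[i] L := by
  rw [opMul, Polynomial.sum_monomial_index]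
  simp

theorem right_div (L : DOp C) (hL : L ≠ 0) (n : ℕ) : ∀ P : DOp C, P.degree < n →
    ∃ Q R : DOp C, P = opMul C Q L + R ∧ R.degree < L.degree := by
  induction n with
  | zero =>
    intro P hP
    have : P = 0 := by
      rw [← degree_eq_bot]
      simpa using hP
    exact ⟨0, 0, by simp [this, opMul], by
      rw [degree_zero]; exact bot_lt_iff_ne_bot.2 (degree_eq_bot.not.2 hL)⟩
  | succ n ih =>
    intro P hP
    by_cases hlt : P.degree < L.degree
    · exact ⟨0, P, by simp [opMul], hlt⟩
    rw [not_lt] at hlt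
    have hP0 : P ≠ 0 := by
      rintro rfl
      rw [degree_zero, le_bot_iff, degree_eq_bot] at hlt
      exact hL hlt
    have hnd : L.natDegree ≤ P.natDegree := natDegree_le_natDegree hlt
    set a := P.leadingCoeff / L.leadingCoeff
    have ha : a ≠ 0 := div_ne_zero (leadingCoeff_ne_zero.2 hP0) (leadingCoeff_ne_zero.2 hL)
    set k := P.natDegree - L.natDegree with hk
    have hl := Dmul_iter_lead C L hL k
    have h0 : (Dmul C)^[k] L ≠ 0 := by
      rw [← leadingCoeff_ne_zero, hl.2]; exact leadingCoeff_ne_zero.2 hL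
    set T := Polynomial.C a * (Dmul C)^[k] L with hT
    have hT0 : T ≠ 0 := mul_ne_zero (C_ne_zero.2 ha) h0
    have hTd : T.natDegree = P.natDegree := by
      rw [hT, natDegree_C_mul ha, hl.1]; omega
    have hTl : T.leadingCoeff = P.leadingCoeff := by
      rw [hT, leadingCoeff_mul, leadingCoeff_C, hl.2]
      exact div_mul_cancel₀ _ (leadingCoeff_ne_zero.2 hL)
    have hdeg : (P - T).degree < P.degree := degree_sub_lt (by
      rw [degree_eq_natDegree hP0, degree_eq_natDegree hT0, hTd]) hP0 hTl.symm
    obtain ⟨Q, R, h1, h2⟩ := ih (P - T) (lt_of_lt_of_le hdeg (by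
      rw [degree_eq_natDegree hP0] at hP ⊢
      have : P.natDegree < n + 1 := by exact_mod_cast hP
      exact_mod_cast Nat.lt_succ_iff.1 this))
    refine ⟨Q + monomial k a, R, ?_, h2⟩
    rw [opMul_add, opMul_monomial, ← hT, add_right_comm, ← h1]
    ring

theorem const_of_delta (F : DiffExt C) (halg : Algebra.IsAlgebraic (RatFunc C) F.carrier)
    (g : F.carrier) (hg : F.δ g = 0) : ∃ c : C, algebraMap C F.carrier c = g := by
  refine exists_const C F halg g ?_
  intro δ hδ ι hι φ hφ
  have key : hderiv C (φ g) = 0 → φ g ∈ intSub C := by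
    intro h γ hγ
    rw [hderiv_eq, mul_eq_zero] at h
    rcases h with h | h
    · simp at h
    · have := congrArg (fun s => HahnSeries.coeff s γ) h
      simp only [theta, HahnSeries.coeff_zero, smul_eq_zero] at this
      exact this.resolve_left hγ.ne
  rcases hδ with rfl | hδ
  · apply key
    rw [← der_transfer C F halg _ (hderiv_isDer C) ι hι φ hφ, hg, map_zero]
  · rw [Set.mem_singleton_iff] at hδ
    subst hδ
    apply key
    have := der_transfer C F halg _ (dinf_isDer C) ι hι φ hφ g
    rw [hg, map_zero, dinf, eq_comm, neg_eq_zero, mul_eq_zero] at this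
    exact this.resolve_left (by simp)

theorem wronskian (F : DiffExt C) (halg : Algebra.IsAlgebraic (RatFunc C) F.carrier)
    (R : DOp C) (n : ℕ) (b : Fin n → F.carrier) (hb : LinearIndependent C b)
    (hR : ∀ i, F.apply C R (b i) = 0) (hd : R.natDegree < n) : R = 0 := by
  classical
  by_contra hR0
  let W : (Fin n → F.carrier) → ℕ → F.carrier := fun c j => ∑ i, c i * F.δ^[j] (b i)
  have hext : ∀ c, (∀ j < R.natDegree, W c j = 0) → ∀ j, W c j = 0 := by
    intro c hc j
    induction j using Nat.strong_induction_on with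
    | _ j ih =>
      rcases lt_or_ge j R.natDegree with h | h
      · exact hc j h
      have hl := Dmul_iter_lead C R hR0 (j - R.natDegree)
      set S := (Dmul C)^[j - R.natDegree] R with hS
      have hSd : S.natDegree = j := by rw [hl.1]; omega
      have hSb : ∀ i, F.apply C S (b i) = 0 := fun i => by
        rw [hS, apply_Dmul_iter, hR, delta_iter_zero]
      have h1 : ∑ i, c i * F.apply C S (b i) = 0 :=
        Finset.sum_eq_zero fun i _ => by rw [hSb, mul_zero]
      have h2 : ∀ f, F.apply C S f = ∑ l ∈ Finset.range (j + 1),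
          algebraMap _ F.carrier (S.coeff l) * F.δ^[l] f := fun f => by
        rw [DiffExt.apply, Polynomial.sum_over_range' _ (fun l => by simp) (j + 1) (by omega)]
      have h3 : ∑ i, c i * F.apply C S (b i) = ∑ l ∈ Finset.range (j + 1),
          algebraMap _ F.carrier (S.coeff l) * W c l := by
        simp only [h2, W, Finset.mul_sum]
        rw [Finset.sum_comm]
        refine Finset.sum_congr rfl fun l _ => Finset.sum_congr rfl fun i _ => ?_
        ring
      rw [h1, Finset.sum_range_succ, Finset.sum_eq_zero, zero_add, eq_comm, mul_eq_zero] at h3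
      · refine h3.resolve_left ?_
        rw [map_eq_zero]
        have : S.coeff j = S.leadingCoeff := by rw [leadingCoeff, hSd]
        rw [this, hl.2]
        exact leadingCoeff_ne_zero.2 hR0
      · intro l hl'
        rw [ih l (Finset.mem_range.1 hl'), mul_zero]
  let V : Set (Fin n → F.carrier) := {c | c ≠ 0 ∧ ∀ j, W c j = 0}
  have hV : V.Nonempty := by
    let T : (Fin n → F.carrier) →ₗ[F.carrier] (Fin R.natDegree → F.carrier) :=
      { toFun := fun c j => W c j
        map_add' := fun c c' => by
          funext j
          simp only [W, Pi.add_apply, add_mul, Finset.sum_add_distrib]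
        map_smul' := fun a c => by
          funext j
          simp only [W, Pi.smul_apply, smul_eq_mul, RingHom.id_apply, Finset.mul_sum, mul_assoc] }
    have hT := LinearMap.ker_ne_bot_of_finrank_lt (f := T) (by simpa using hd)
    obtain ⟨c, hc, hc0⟩ := Submodule.exists_mem_ne_zero_of_ne_bot hT
    refine ⟨c, hc0, hext c fun j hj => ?_⟩
    exact congrFun (LinearMap.mem_ker.1 hc) ⟨j, hj⟩
  let g : (Fin n → F.carrier) → ℕ := fun c => (Finset.univ.filter fun i => c i ≠ 0).card
  obtain ⟨c, ⟨hc0, hcW⟩, hmin⟩ := (measure g).wf.has_min V hV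
  obtain ⟨i0, hi0⟩ : ∃ i, c i ≠ 0 := by
    by_contra! h
    exact hc0 (funext h)
  let c' : Fin n → F.carrier := fun i => (c i0)⁻¹ * c i
  have hc'1 : c' i0 = 1 := inv_mul_cancel₀ hi0
  have hc'W : ∀ j, W c' j = 0 := fun j => by
    have : W c' j = (c i0)⁻¹ * W c j := by
      simp only [W, c', Finset.mul_sum, mul_assoc]
    rw [this, hcW, mul_zero]
  let d : Fin n → F.carrier := fun i => F.δ (c' i)
  have hdW : ∀ j, W d j = 0 := fun j => by
    have h1 : F.δ (W c' j) = W c' (j + 1) + W d j := by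
      simp only [W, d]
      rw [(delta_isDer C F).sum, ← Finset.sum_add_distrib]
      refine Finset.sum_congr rfl fun i _ => ?_
      rw [F.δ_mul, Function.iterate_succ_apply']
    rw [hc'W, hc'W, (delta_isDer C F).zero, zero_add] at h1
    exact h1.symm
  have hd0 : d = 0 := by
    by_contra hne
    refine hmin d ⟨hne, hdW⟩ ?_
    change g d < g c
    refine Finset.card_lt_card ?_
    rw [Finset.ssubset_iff_of_subset]
    · refine ⟨i0, by simpa using hi0, ?_⟩
      simp only [Finset.mem_filter, not_and, not_not]
      intro _
      simp only [d, hc'1]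
      exact (delta_isDer C F).one
    · intro i hi
      simp only [Finset.mem_filter, Finset.mem_univ, true_and] at hi ⊢
      intro h
      apply hi
      simp only [d, c', h, mul_zero]
      exact (delta_isDer C F).zero
  choose e he using fun i => const_of_delta C F halg (c' i) (congrFun hd0 i)
  have hrel : ∑ i, e i • b i = 0 := by
    rw [← hc'W 0]
    simp only [W, Function.iterate_zero, id]
    refine Finset.sum_congr rfl fun i _ => ?_
    rw [← he, Algebra.smul_def]
  have := Fintype.linearIndependent_iff.1 hb e hrel i0
  have h1 := he i0
  rw [this, map_zero, hc'1] at h1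
  exact zero_ne_one h1

theorem main (L : DOp C)
    (h : HasPseudoconstant C L) : ¬ AllAlgebraic C L := by
  obtain ⟨P, hP, hnc⟩ := h
  rintro ⟨F, halg, b, hb, hli⟩
  apply hnc
  have hkill : ∀ f, F.apply C L f = 0 → F.apply C (Dmul C P) f = 0 := by
    intro f hf
    have hder : ∀ δ ∈ ({hderiv C, dinf C} : Set (HahnSeries ℚ C → HahnSeries ℚ C)),
        IsDer (RingHom.id _) δ := by
      intro δ hδ
      rcases hδ with rfl | rfl
      · exact hderiv_isDer C
      · exact dinf_isDer C
    obtain ⟨c, hc⟩ := exists_const C F halg (F.apply C P f) (by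
      intro δ hδ ι hι φ hφ
      have hd := der_transfer C F halg δ (hder δ hδ) ι hι φ hφ
      rw [apply_transfer C F δ ι φ hφ hd]
      refine hP δ hδ ι hι _ ?_
      rw [← apply_transfer C F δ ι φ hφ hd, hf, map_zero])
    rw [apply_Dmul, ← hc, IsScalarTower.algebraMap_apply C (RatFunc C) F.carrier,
      F.δ_algebraMap, KDeriv_C, map_zero]
  by_cases hL : L = 0
  · subst hL
    refine ⟨0, ?_⟩
    have h0 : opMul C 0 (0 : DOp C) = 0 := by simp [opMul]
    rw [h0]
    refine wronskian C F halg (Dmul C P) ((Dmul C P).natDegree + 1)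
      (fun i => algebraMap (RatFunc C) F.carrier (RatFunc.X ^ (i : ℕ))) ?_
      (fun i => hkill _ (apply_zero_op C F _)) (Nat.lt_succ_self _)
    rw [Fintype.linearIndependent_iff]
    intro e he i
    have h1 : algebraMap (RatFunc C) F.carrier (algebraMap C[X] (RatFunc C)
        (∑ i, Polynomial.C (e i) * X ^ (i : ℕ))) = 0 := by
      rw [← he, map_sum, map_sum]
      refine Finset.sum_congr rfl fun i _ => ?_
      rw [Algebra.smul_def, IsScalarTower.algebraMap_apply C (RatFunc C) F.carrier, ← map_mul]
      congr 1
      rw [map_mul, map_pow, RatFunc.algebraMap_X]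
      rfl
    rw [map_eq_zero, map_eq_zero_iff _ (RatFunc.algebraMap_injective C)] at h1
    have h2 := congrArg (fun p => coeff p (i : ℕ)) h1
    simp only [finset_sum_coeff, coeff_C_mul_X_pow, coeff_zero] at h2
    rw [Finset.sum_eq_single i] at h2
    · simpa using h2
    · intro j _ hj
      rw [if_neg]
      intro h
      exact hj (Fin.ext h.symm)
    · intro h; exact absurd (Finset.mem_univ i) h
  · obtain ⟨Q, R, h1, h2⟩ := right_div C L hL ((Dmul C P).natDegree + 1) (Dmul C P)
      (lt_of_le_of_lt degree_le_natDegree (by exact_mod_cast Nat.lt_succ_self _))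
    refine ⟨Q, ?_⟩
    by_cases hR0 : R = 0
    · rw [h1, hR0, add_zero]
    · have : R = 0 := by
        refine wronskian C F halg R L.natDegree b hli (fun i => ?_)
          (natDegree_lt_natDegree hR0 h2)
        have h3 := hkill (b i) (hb i)
        rwa [h1, apply_add, apply_opMul_zero C F Q L _ (hb i), zero_add] at h3
      exact absurd this hR0

end PsC

/-- Theorem: if `L` has a pseudoconstant then `L` admits at least one transcendental
solution, i.e. it is not the case that all solutions of `L` are algebraic. -/
theorem pseudoconstant_implies_transcendental_solution (L : DOp C)
    (h : HasPseudoconstant C L) : ¬ AllAlgebraic C L := by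
  exact PsC.main C L h

end
end

section
/- Suppose all solutions f₁,…,f_r of L form a basis of V(L) and each f_i is algebraic over C(x). Then the order of the s-th symmetric power satisfies ord(L^{⊗s}) = O(s) as s → ∞. -/
/- Framework: linear differential operators over K = C(x), represented as
   `Polynomial (RatFunc C)` where `X^i` stands for `D^i` (coefficients on the left);
   local (Puiseux/Hahn series) solutions at finite points and at infinity;
   integrality; constants and pseudoconstants of `K[D]/⟨L⟩`. -/

noncomputable section
open Polynomial

variable (C : Type) [Field C] [IsAlgClosed C] [CharZero C]

theorem dext_sum (F : DiffExt C) {ι : Type*} (S : Finset ι) (g : ι → F.carrier) :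
    F.δ (∑ i ∈ S, g i) = ∑ i ∈ S, F.δ (g i) := by
  exact map_sum (AddMonoidHom.mk' F.δ F.δ_add) g S

theorem dext_prod (F : DiffExt C) {ι : Type*} [DecidableEq ι] (S : Finset ι)
    (g : ι → F.carrier) :
    F.δ (∏ i ∈ S, g i) = ∑ j ∈ S, ∏ l ∈ S, Function.update g j (F.δ (g j)) l := by
  induction S using Finset.induction_on with
  | empty =>
    have := F.δ_mul 1 1
    simpa using this
  | insert a S ha ih =>
    rw [Finset.prod_insert ha, F.δ_mul, ih, Finset.sum_insert ha, Finset.prod_insert ha,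
      Function.update_self, add_comm]
    congr 1
    · congr 1
      refine Finset.prod_congr rfl fun l hl => ?_
      rw [Function.update_of_ne]
      rintro rfl; exact ha hl
    · rw [Finset.mul_sum]
      refine Finset.sum_congr rfl fun j hj => ?_
      rw [Finset.prod_insert ha, Function.update_of_ne]
      rintro rfl; exact ha hj

theorem dext_const (F : DiffExt C) (c : C) : F.δ (algebraMap C F.carrier c) = 0 := by
  rw [IsScalarTower.algebraMap_apply C (RatFunc C) F.carrier, F.δ_algebraMap,
    RatFunc.algebraMap_eq_C]
  simp [KDeriv]

theorem dext_smul (F : DiffExt C) (c : C) (g : F.carrier) : F.δ (c • g) = c • F.δ g := by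
  rw [Algebra.smul_def, F.δ_mul, dext_const, Algebra.smul_def]; ring

/-- The derivation as a C-linear map. -/
def dlin (F : DiffExt C) : F.carrier →ₗ[C] F.carrier where
  toFun := F.δ
  map_add' := F.δ_add
  map_smul' := dext_smul C F

theorem dlin_pow (F : DiffExt C) (k : ℕ) (g : F.carrier) :
    ((dlin C F) ^ k) g = F.δ^[k] g := by
  rw [Module.End.pow_apply]; rfl

theorem apply_eq (F : DiffExt C) (L : DOp C) (n : ℕ) (hn : L.natDegree < n) (g : F.carrier) :
    F.apply C L g = ∑ k : Fin n, algebraMap (RatFunc C) F.carrier (L.coeff k) * F.δ^[k] g := by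
  rw [DiffExt.apply, Polynomial.sum_over_range' _ _ n hn, Finset.sum_range]
  simp

/-- Companion reduction. -/
theorem dstep (L : DOp C) (hL : L ≠ 0) : ∃ A : Fin L.natDegree → Fin L.natDegree → RatFunc C,
    ∀ F : DiffExt C, ∀ g : F.carrier, F.apply C L g = 0 → ∀ m : Fin L.natDegree,
      F.δ (F.δ^[m] g) = ∑ n, algebraMap (RatFunc C) F.carrier (A m n) * F.δ^[n] g := by
  classical
  refine ⟨fun m n => if (m : ℕ) + 1 < L.natDegree then (if (n : ℕ) = m + 1 then 1 else 0)
    else - (L.coeff n / L.leadingCoeff), ?_⟩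
  intro F g hg m
  rw [← Function.iterate_succ_apply' F.δ]
  by_cases hm : (m : ℕ) + 1 < L.natDegree
  · rw [Finset.sum_eq_single ⟨m + 1, hm⟩]
    · simp [hm]
    · intro b _ hb
      have : (b : ℕ) ≠ m + 1 := fun h => hb (Fin.ext h)
      simp [hm, this]
    · simp
  · have hm' : (m : ℕ) + 1 = L.natDegree := by have := m.2; omega
    simp only [hm, if_false]
    rw [apply_eq C F L (L.natDegree + 1) (by omega), Fin.sum_univ_castSucc] at hg
    simp only [Fin.val_castSucc, Fin.val_last] at hg
    have hl : algebraMap (RatFunc C) F.carrier L.leadingCoeff ≠ 0 := by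
      simpa using hL
    apply mul_left_cancel₀ hl
    rw [Finset.mul_sum, Nat.succ_eq_add_one, hm']
    change _ + algebraMap (RatFunc C) F.carrier L.leadingCoeff * _ = 0 at hg
    rw [eq_neg_of_add_eq_zero_right hg, ← Finset.sum_neg_distrib]
    refine Finset.sum_congr rfl fun n _ => ?_
    rw [map_neg, map_div₀]
    field_simp

theorem dprod (L : DOp C) (hL : L ≠ 0) (s : ℕ) (k : ℕ) :
    ∃ P : (Fin s → Fin L.natDegree) → RatFunc C,
    ∀ F : DiffExt C, ∀ g : Fin s → F.carrier, (∀ j, F.apply C L (g j) = 0) →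
      F.δ^[k] (∏ j, g j) =
        ∑ m, algebraMap (RatFunc C) F.carrier (P m) * ∏ j, F.δ^[m j] (g j) := by
  classical
  induction k with
  | zero =>
    by_cases hr : L.natDegree = 0
    · -- order zero: solutions vanish
      have hz : ∀ F : DiffExt C, ∀ g : F.carrier, F.apply C L g = 0 → g = 0 := by
        intro F g hg
        rw [apply_eq C F L 1 (by omega)] at hg
        have hl : algebraMap (RatFunc C) F.carrier (L.coeff 0) ≠ 0 := by
          have : L.leadingCoeff ≠ 0 := by simpa using hL
          rw [Polynomial.leadingCoeff, hr] at this
          simpa using this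
        simpa [hl] using hg
      rcases Nat.eq_zero_or_pos s with rfl | hs
      · exact ⟨fun _ => 1, fun F g _ => by simp⟩
      · refine ⟨fun _ => 0, fun F g hg => ?_⟩
        simp only [map_zero, zero_mul, Finset.sum_const_zero, Function.iterate_zero, id]
        exact Finset.prod_eq_zero (Finset.mem_univ ⟨0, hs⟩) (hz F _ (hg _))
    · have hr' : 0 < L.natDegree := Nat.pos_of_ne_zero hr
      refine ⟨Pi.single (fun _ => ⟨0, hr'⟩) 1, fun F g _ => ?_⟩
      rw [Finset.sum_eq_single (fun _ => ⟨0, hr'⟩)]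
      · simp
      · intro b _ hb
        simp [Pi.single_eq_of_ne hb]
      · simp
  | succ k ih =>
    obtain ⟨P, hP⟩ := ih
    obtain ⟨A, hA⟩ := dstep C L hL
    let ev : ∀ F : DiffExt C, (Fin s → F.carrier) →
        (((Fin s → Fin L.natDegree) → RatFunc C) →+ F.carrier) := fun F g =>
      AddMonoidHom.mk' (fun Q => ∑ m, algebraMap (RatFunc C) F.carrier (Q m) *
        ∏ j, F.δ^[m j] (g j)) (fun a b => by
          simp only [Pi.add_apply, map_add, add_mul, Finset.sum_add_distrib])
    have ev1 : ∀ F g m a, ev F g (Pi.single m a) =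
        algebraMap (RatFunc C) F.carrier a * ∏ j, F.δ^[m j] (g j) := by
      intro F g m a
      simp only [ev, AddMonoidHom.mk'_apply]
      rw [Finset.sum_eq_single m]
      · simp
      · intro b _ hb
        simp [Pi.single_eq_of_ne hb]
      · simp
    refine ⟨(fun m => KDeriv C (P m)) +
      ∑ m, ∑ j, ∑ n, Pi.single (Function.update m j n) (P m * A (m j) n), ?_⟩
    intro F g hg
    change _ = ev F g _
    rw [map_add, map_sum, Function.iterate_succ_apply', hP F g hg, dext_sum]
    simp only [F.δ_mul, F.δ_algebraMap, Finset.sum_add_distrib]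
    rw [add_comm]
    congr 1
    refine Finset.sum_congr rfl fun m _ => ?_
    rw [dext_prod, map_sum, Finset.mul_sum]
    refine Finset.sum_congr rfl fun j _ => ?_
    rw [map_sum, hA F _ (hg j)]
    simp only [ev1]
    rw [← Finset.mul_prod_erase _ _ (Finset.mem_univ j), Function.update_self, Finset.sum_mul,
      Finset.mul_sum]
    refine Finset.sum_congr rfl fun n _ => ?_
    rw [← Finset.mul_prod_erase _ (fun l => F.δ^[Function.update m j n l] (g l))
      (Finset.mem_univ j), Function.update_self, map_mul]
    have : ∏ x ∈ Finset.univ.erase j, Function.update (fun j => F.δ^[m j] (g j)) j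
        (∑ n, algebraMap (RatFunc C) F.carrier (A (m j) n) * F.δ^[n] (g j)) x
        = ∏ x ∈ Finset.univ.erase j, F.δ^[Function.update m j n x] (g x) := by
      refine Finset.prod_congr rfl fun l hl => ?_
      have hl' := Finset.ne_of_mem_erase hl
      rw [Function.update_of_ne hl', Function.update_of_ne hl']
    rw [this]; ring

theorem const_mem (L : DOp C) (F : DiffExt C) (f : Fin L.natDegree → F.carrier)
    (hsol : ∀ i, F.apply C L (f i) = 0)
    (hli : LinearIndependent C f)
    (hspan : ∀ g : F.carrier, F.apply C L g = 0 → g ∈ Submodule.span C (Set.range f))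
    (hr : 0 < L.natDegree) (c : F.carrier) (hc : F.δ c = 0) :
    ∃ a : C, algebraMap C F.carrier a = c := by
  set V := Submodule.span C (Set.range f) with hV
  have hci : ∀ k g, F.δ^[k] (c * g) = c * F.δ^[k] g := by
    intro k g
    induction k with
    | zero => rfl
    | succ k ih =>
      rw [Function.iterate_succ_apply', ih, F.δ_mul, hc, Function.iterate_succ_apply']; ring
  have hmul : ∀ v ∈ V, (LinearMap.mulLeft C c) v ∈ V := by
    intro v hv
    induction hv using Submodule.span_induction with
    | mem x hx =>
      obtain ⟨i, rfl⟩ := hx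
      apply hspan
      have h := hsol i
      rw [apply_eq C F L _ (Nat.lt_succ_self _)] at h ⊢
      simp only [LinearMap.mulLeft_apply, hci]
      rw [← mul_zero c, ← h, Finset.mul_sum]
      exact Finset.sum_congr rfl fun _ _ => by ring
    | zero => simp
    | add x y _ _ hx hy => rw [map_add]; exact V.add_mem hx hy
    | smul a x _ hx => rw [map_smul]; exact V.smul_mem _ hx
  have : FiniteDimensional C V := FiniteDimensional.span_of_finite C (Set.finite_range f)
  have : Nontrivial V := by
    refine ⟨⟨⟨f ⟨0, hr⟩, Submodule.subset_span ⟨_, rfl⟩⟩, 0, fun h => ?_⟩⟩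
    exact hli.ne_zero ⟨0, hr⟩ (congrArg Subtype.val h)
  obtain ⟨a, ha⟩ := Module.End.exists_eigenvalue ((LinearMap.mulLeft C c).restrict hmul)
  obtain ⟨v, hv⟩ := ha.exists_hasEigenvector
  refine ⟨a, ?_⟩
  have h1 := congrArg Subtype.val hv.apply_eq_smul
  have h2 : (v : F.carrier) ≠ 0 := fun h => hv.2 (Subtype.ext h)
  simp only [LinearMap.coe_restrict_apply, LinearMap.mulLeft_apply, Submodule.coe_smul,
    Algebra.smul_def] at h1
  exact (mul_right_cancel₀ h2 h1).symm

theorem wronsk (L : DOp C) (hL : L ≠ 0) (F : DiffExt C) (f : Fin L.natDegree → F.carrier)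
    (hsol : ∀ i, F.apply C L (f i) = 0)
    (hli : LinearIndependent C f)
    (hspan : ∀ g : F.carrier, F.apply C L g = 0 → g ∈ Submodule.span C (Set.range f)) :
    (Matrix.of fun k i : Fin L.natDegree => F.δ^[k] (f i)).det ≠ 0 := by
  classical
  intro hdet
  obtain ⟨A, hA⟩ := dstep C L hL
  let Q : ℕ → Prop := fun N => ∃ c : Fin L.natDegree → F.carrier, c ≠ 0 ∧
    (∀ k : Fin L.natDegree, ∑ i, F.δ^[k] (f i) * c i = 0) ∧
    (Finset.univ.filter fun i => c i ≠ 0).card = N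
  have hQ : ∃ N, Q N := by
    obtain ⟨v, hv, hv2⟩ := Matrix.exists_mulVec_eq_zero_iff.2 hdet
    refine ⟨_, v, hv, fun k => ?_, rfl⟩
    have := congrFun hv2 k
    simpa [Matrix.mulVec, dotProduct] using this
  obtain ⟨c, hc0, hc, hcard⟩ := Nat.find_spec hQ
  obtain ⟨i0, hi0⟩ := Function.ne_iff.1 hc0
  simp only [Pi.zero_apply] at hi0
  -- normalise
  set e : Fin L.natDegree → F.carrier := fun i => c i / c i0 with he
  have he0 : e i0 = 1 := div_self hi0
  have heS : ∀ i, e i = 0 ↔ c i = 0 := by intro i; simp [he, hi0]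
  have hek : ∀ k : Fin L.natDegree, ∑ i, F.δ^[k] (f i) * e i = 0 := by
    intro k
    simp only [he, mul_div_assoc', ← Finset.sum_div, hc k, zero_div]
  have hd1 : F.δ 1 = 0 := by
    have := F.δ_mul 1 1
    simpa using this
  have hd0 : F.δ 0 = 0 := by
    have := F.δ_add 0 0
    simpa using this
  have hde : ∀ k : Fin L.natDegree, ∑ i, F.δ^[k] (f i) * F.δ (e i) = 0 := by
    intro k
    have h1 := congrArg F.δ (hek k)
    rw [dext_sum, hd0] at h1
    simp only [F.δ_mul, Finset.sum_add_distrib] at h1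
    have h2 : ∑ i, F.δ (F.δ^[k] (f i)) * e i = 0 := by
      simp only [hA F _ (hsol _), Finset.sum_mul]
      rw [Finset.sum_comm]
      refine Finset.sum_eq_zero fun n _ => ?_
      simp only [mul_assoc, ← Finset.mul_sum, hek n, mul_zero]
    rwa [h2, add_zero] at h1
  have hdz : (fun i => F.δ (e i)) = 0 := by
    by_contra hne
    have hlt : (Finset.univ.filter fun i => F.δ (e i) ≠ 0).card < Nat.find hQ := by
      rw [← hcard]
      apply Finset.card_lt_card
      rw [Finset.ssubset_iff_of_subset]
      · exact ⟨i0, by simp [hi0], by simp [he0, hd1]⟩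
      · intro i hi
        simp only [Finset.mem_filter, Finset.mem_univ, true_and] at hi ⊢
        intro h
        exact hi (by rw [(heS i).2 h, hd0])
    exact Nat.find_min hQ hlt ⟨_, hne, hde, rfl⟩
  have hr : 0 < L.natDegree := i0.pos
  choose a ha using fun i => const_mem C L F f hsol hli hspan hr (e i) (congrFun hdz i)
  have h0 := hek ⟨0, hr⟩
  have := Fintype.linearIndependent_iff.1 hli a (by
    rw [← h0]
    refine Finset.sum_congr rfl fun i _ => ?_
    rw [Algebra.smul_def, ha, mul_comm]; rfl) i0
  rw [← ha, this, map_zero] at he0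
  exact zero_ne_one he0

theorem hilb (F : DiffExt C) (r : ℕ) (f : Fin r → F.carrier)
    (halg : ∀ i, IsAlgebraic (RatFunc C) (f i)) :
    ∃ c : ℕ, ∀ s : ℕ, ∃ U : Submodule C F.carrier, FiniteDimensional C U ∧
      Module.finrank C U ≤ c * s + c ∧ ∀ i : Fin s → Fin r, ∏ j, f (i j) ∈ U := by
  classical
  let E := IntermediateField.adjoin (RatFunc C) (Set.range f)
  have : FiniteDimensional (RatFunc C) E := by
    have : Finite (Set.range f) := Set.finite_range f
    apply IntermediateField.finiteDimensional_adjoin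
    rintro _ ⟨i, rfl⟩
    exact (halg i).isIntegral
  let b := Module.finBasis (RatFunc C) E
  set n := Module.finrank (RatFunc C) E with hn
  let f' : Fin r → E := fun i => ⟨f i, IntermediateField.subset_adjoin _ _ ⟨i, rfl⟩⟩
  obtain ⟨⟨q, hq⟩, hqM⟩ := IsLocalization.exist_integer_multiples_of_finite
    (nonZeroDivisors C[X])
    (Sum.elim (fun t : Fin r × Fin n × Fin n => b.repr (f' t.1 * b t.2.1) t.2.2)
      (fun l : Fin n => b.repr 1 l))
  have hq0 : q ≠ 0 := nonZeroDivisors.ne_zero hq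
  choose p hp using hqM
  let B := Finset.univ.sup fun t => (p t).natDegree
  have hB : ∀ t, (p t).natDegree ≤ B := fun t =>
    Finset.le_sup (f := fun t => (p t).natDegree) (Finset.mem_univ t)
  set φ := algebraMap C[X] (RatFunc C) with hφ
  have hφq : φ q ≠ 0 := by
    simpa [hφ] using hq0
  let e : Fin n → F.carrier := fun l => (b l : F.carrier)
  let ψ := algebraMap (RatFunc C) F.carrier
  have hψq : ψ (φ q) ≠ 0 := by simpa using hφq
  -- relations
  have hone : ψ (φ q) = ∑ l, ψ (φ (p (Sum.inr l))) * e l := by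
    have h := congrArg (fun z : E => ((φ q • z : E) : F.carrier)) (b.sum_repr 1)
    simp only [Finset.smul_sum, smul_smul] at h
    have h2 : ((φ q • (1 : E) : E) : F.carrier) = ψ (φ q) := by
      simp [Algebra.smul_def, ψ]
    rw [h2] at h
    rw [← h, AddSubmonoidClass.coe_finsetSum]
    refine Finset.sum_congr rfl fun l _ => ?_
    rw [hp (Sum.inr l)]
    simp [Algebra.smul_def, ψ, e, hφ]
  have hmul : ∀ i k, ψ (φ q) * (f i * e k) = ∑ l, ψ (φ (p (Sum.inl (i, k, l)))) * e l := by
    intro i k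
    have h := congrArg (fun z : E => ((φ q • z : E) : F.carrier)) (b.sum_repr (f' i * b k))
    simp only [Finset.smul_sum, smul_smul] at h
    have h2 : ((φ q • (f' i * b k) : E) : F.carrier) = ψ (φ q) * (f i * e k) := by
      simp [Algebra.smul_def, ψ, e, f']
    rw [h2] at h
    rw [← h, AddSubmonoidClass.coe_finsetSum]
    refine Finset.sum_congr rfl fun l _ => ?_
    rw [hp (Sum.inl (i, k, l))]
    simp [Algebra.smul_def, ψ, e, hφ]
  have key : ∀ s (i : Fin s → Fin r), ∃ P : Fin n → C[X], (∀ l, (P l).natDegree ≤ B * (s + 1)) ∧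
      ψ (φ q) ^ (s + 1) * ∏ j, f (i j) = ∑ l, ψ (φ (P l)) * e l := by
    intro s
    induction s with
    | zero =>
      intro i
      exact ⟨fun l => p (Sum.inr l), fun l => by simpa using hB _, by simpa using hone⟩
    | succ s ih =>
      intro i
      obtain ⟨P, hP, hP2⟩ := ih (fun j => i j.succ)
      refine ⟨fun l => ∑ k, P k * p (Sum.inl (i 0, k, l)), fun l => ?_, ?_⟩
      · apply Polynomial.natDegree_sum_le_of_forall_le
        intro k _
        refine Polynomial.natDegree_mul_le.trans ?_
        have := hP k
        have := hB (Sum.inl (i 0, k, l))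
        rw [mul_add B (s+1) 1]; omega
      · rw [Fin.prod_univ_succ]
        calc ψ (φ q) ^ (s + 1 + 1) * (f (i 0) * ∏ j : Fin s, f (i j.succ))
            = (ψ (φ q) * f (i 0)) * (ψ (φ q) ^ (s + 1) * ∏ j : Fin s, f (i j.succ)) := by ring
          _ = ∑ k, ψ (φ (P k)) * (ψ (φ q) * (f (i 0) * e k)) := by
            rw [hP2, Finset.mul_sum]
            exact Finset.sum_congr rfl fun _ _ => by ring
          _ = _ := by
            simp only [hmul, Finset.mul_sum, map_sum, map_mul, Finset.sum_mul]
            rw [Finset.sum_comm]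
            exact Finset.sum_congr rfl fun _ _ => Finset.sum_congr rfl fun _ _ => by ring
  refine ⟨n * (B + 1), fun s => ?_⟩
  let w : Fin n × Fin (B * (s + 1) + 1) → F.carrier := fun t =>
    (ψ (φ q) ^ (s + 1))⁻¹ * (ψ (φ (X ^ (t.2 : ℕ))) * e t.1)
  refine ⟨Submodule.span C (Set.range w),
    FiniteDimensional.span_of_finite C (Set.finite_range w), ?_, ?_⟩
  · refine (finrank_range_le_card w).trans ?_
    simp only [Fintype.card_prod, Fintype.card_fin]
    nlinarith [Nat.zero_le (n * s)]
  · intro i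
    obtain ⟨P, hP, hP2⟩ := key s i
    have : ∏ j, f (i j) = ∑ l, ∑ t : Fin (B * (s + 1) + 1), (P l).coeff t • w (l, t) := by
      have h3 : ∏ j, f (i j) = (ψ (φ q) ^ (s + 1))⁻¹ * ∑ l, ψ (φ (P l)) * e l := by
        rw [← hP2, inv_mul_cancel_left₀ (pow_ne_zero _ hψq)]
      rw [h3, Finset.mul_sum]
      refine Finset.sum_congr rfl fun l _ => ?_
      conv_lhs => rw [(P l).as_sum_range' _ (Nat.lt_succ_of_le (hP l)), Finset.sum_range]
      simp only [map_sum, Finset.sum_mul, Finset.mul_sum]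
      refine Finset.sum_congr rfl fun t _ => ?_
      have : ψ (φ (monomial t ((P l).coeff t))) =
          algebraMap C F.carrier ((P l).coeff t) * ψ (φ (X ^ (t : ℕ))) := by
        rw [← Polynomial.C_mul_X_pow_eq_monomial, map_mul, map_mul,
          IsScalarTower.algebraMap_apply C (RatFunc C) F.carrier]
        rfl
      rw [Algebra.smul_def, this]
      simp only [w]
      ring
    rw [this]
    exact Submodule.sum_mem _ fun l _ => Submodule.sum_mem _ fun t _ =>
      Submodule.smul_mem _ _ (Submodule.subset_span ⟨_, rfl⟩)

theorem ann_exists (F : DiffExt C) (U : Submodule C F.carrier) [FiniteDimensional C U] (d : ℕ)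
    (hd : Module.finrank C U < d) :
    ∃ c : Fin d → F.carrier, c ≠ 0 ∧ ∀ v ∈ U, ∑ k : Fin d, c k * F.δ^[k] v = 0 := by
  let b := Module.finBasis C U
  let T : (Fin d → F.carrier) →ₗ[F.carrier] (Fin (Module.finrank C U) → F.carrier) :=
    LinearMap.pi fun t => ∑ k : Fin d, (F.δ^[k] (b t : F.carrier)) • LinearMap.proj k
  have hker : LinearMap.ker T ≠ ⊥ := LinearMap.ker_ne_bot_of_finrank_lt (by simpa using hd)
  obtain ⟨c, hc, hc0⟩ := (Submodule.ne_bot_iff _).1 hker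
  refine ⟨c, hc0, fun v hv => ?_⟩
  have hb : ∀ t, ∑ k : Fin d, c k * F.δ^[k] (b t : F.carrier) = 0 := by
    intro t
    have := congrFun (LinearMap.mem_ker.1 hc) t
    simpa [T, mul_comm] using this
  let M : F.carrier →ₗ[C] F.carrier :=
    ∑ k : Fin d, (LinearMap.mulLeft C (c k)).comp ((dlin C F) ^ (k : ℕ))
  have hM : ∀ v, M v = ∑ k : Fin d, c k * F.δ^[k] v := by
    intro v; simp [M, LinearMap.sum_apply, dlin_pow]
  rw [← hM]
  have h0 : M.comp U.subtype = 0 := by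
    apply b.ext
    intro t
    simp [hM, hb]
  exact LinearMap.congr_fun h0 ⟨v, hv⟩

/-- Theorem (1): if all solutions of `L` (a basis `f₁,…,f_r` of `V(L)`) are algebraic,
then `ord (L^{⊗s}) = O(s)` as `s → ∞`. -/
theorem sympow_order_linear_of_algebraic (L : DOp C) (F : DiffExt C)
    (f : Fin L.natDegree → F.carrier)
    (hsol : ∀ i, F.apply C L (f i) = 0)
    (hli : LinearIndependent C f)
    (hspan : ∀ g : F.carrier, F.apply C L g = 0 → g ∈ Submodule.span C (Set.range f))
    (halg : ∀ i, IsAlgebraic (RatFunc C) (f i))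
    (Sym : ℕ → DOp C) (hSym : ∀ s, IsSymPow C L (Sym s) s) :
    ∃ c : ℕ, ∀ s : ℕ, (Sym s).natDegree ≤ c * s + c := by
  classical
  have hL : L ≠ 0 := by
    rintro rfl
    have h1 := hspan 1 (by simp [DiffExt.apply])
    have : IsEmpty (Fin (0 : DOp C).natDegree) := by
      rw [Polynomial.natDegree_zero]; infer_instance
    rw [Set.range_eq_empty, Submodule.span_empty, Submodule.mem_bot] at h1
    exact one_ne_zero h1
  obtain ⟨c, hc⟩ := hilb C F _ f halg
  refine ⟨c, fun s => ?_⟩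
  obtain ⟨U, hU, hUr, hUf⟩ := hc s
  refine le_trans ?_ hUr
  by_contra hlt
  push Not at hlt
  set d := (Sym s).natDegree with hd
  obtain ⟨a, ha0, ha⟩ := ann_exists C F U d hlt
  choose P hP using dprod C L hL s
  set W := (Matrix.of fun k i : Fin L.natDegree => F.δ^[k] (f i)) with hW
  have hdet : IsUnit W.det := (wronsk C L hL F f hsol hli hspan).isUnit
  have hWi : W * W⁻¹ = 1 := Matrix.mul_nonsing_inv W hdet
  -- F-linear relation
  have hrel : ∀ m, ∑ k : Fin d, a k * algebraMap (RatFunc C) F.carrier (P k m) = 0 := by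
    let R : (Fin s → Fin L.natDegree) → F.carrier := fun m =>
      ∑ k : Fin d, a k * algebraMap (RatFunc C) F.carrier (P k m)
    have h1 : ∀ i : Fin s → Fin L.natDegree, ∑ m, R m * ∏ j, W (m j) (i j) = 0 := by
      intro i
      rw [← ha _ (hUf i)]
      simp only [hP _ F (fun j => f (i j)) (fun j => hsol _), R, Finset.sum_mul, Finset.mul_sum]
      rw [Finset.sum_comm]
      exact Finset.sum_congr rfl fun _ _ => Finset.sum_congr rfl fun _ _ => by
        simp only [hW, Matrix.of_apply]; ring
    intro n
    have h2 : ∑ i : Fin s → Fin L.natDegree,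
        (∑ m, R m * ∏ j, W (m j) (i j)) * ∏ j, W⁻¹ (i j) (n j) = R n := by
      simp only [Finset.sum_mul]
      rw [Finset.sum_comm]
      have h3 : ∀ m : Fin s → Fin L.natDegree, ∑ i : Fin s → Fin L.natDegree,
          R m * (∏ j, W (m j) (i j)) * ∏ j, W⁻¹ (i j) (n j) = R m * if m = n then 1 else 0 := by
        intro m
        simp only [mul_assoc, ← Finset.mul_sum, ← Finset.prod_mul_distrib]
        congr 1
        rw [← Fintype.prod_sum (fun j x => W (m j) x * W⁻¹ x (n j))]
        have h4 : ∀ j, ∑ x, W (m j) x * W⁻¹ x (n j) = if m j = n j then 1 else 0 := by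
          intro j
          rw [← Matrix.mul_apply, hWi, Matrix.one_apply]
        simp only [h4]
        rw [Finset.prod_ite_zero]
        simp [funext_iff]
      simp only [h3]
      simp
    change R n = 0
    rw [← h2]
    simp [h1]
  obtain ⟨k0, hk0⟩ := Function.ne_iff.1 ha0
  have : ∃ φ : Module.Dual (RatFunc C) F.carrier, φ (a k0) ≠ 0 := by
    by_contra h
    push Not at h
    exact hk0 ((Module.forall_dual_apply_eq_zero_iff (RatFunc C) (a k0)).1 h)
  obtain ⟨φ, hφ⟩ := this
  have hrelK : ∀ m, ∑ k : Fin d, φ (a k) * P k m = 0 := by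
    intro m
    have := congrArg φ (hrel m)
    rw [map_sum, map_zero] at this
    rw [← this]
    refine Finset.sum_congr rfl fun k _ => ?_
    rw [mul_comm (a k), ← Algebra.smul_def, map_smul, smul_eq_mul, mul_comm]
  let S0 : DOp C := ∑ k : Fin d, monomial (k : ℕ) (φ (a k))
  have hS0c : ∀ k : Fin d, S0.coeff k = φ (a k) := by
    intro k
    simp only [S0, Polynomial.finsetSum_coeff, Polynomial.coeff_monomial]
    rw [Finset.sum_eq_single k]
    · simp
    · intro b _ hb
      simp [Fin.val_inj, hb]
    · simp
  have hS0 : S0 ≠ 0 := by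
    intro h
    apply hφ
    rw [← hS0c, h, Polynomial.coeff_zero]
  have hS0d : S0.natDegree < d := by
    rw [Polynomial.natDegree_lt_iff_degree_lt hS0]
    refine (Polynomial.degree_sum_le _ _).trans_lt ?_
    rw [Finset.sup_lt_iff (WithBot.bot_lt_coe _)]
    intro k _
    exact (Polynomial.degree_monomial_le _ _).trans_lt (by exact_mod_cast k.2)
  have hlc : S0.leadingCoeff⁻¹ ≠ 0 := inv_ne_zero (by simpa using hS0)
  let S' : DOp C := Polynomial.C (S0.leadingCoeff⁻¹) * S0
  have hS'd : S'.natDegree = S0.natDegree := Polynomial.natDegree_C_mul hlc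
  have hS'm : S'.Monic := by
    rw [Polynomial.Monic, Polynomial.leadingCoeff_mul, Polynomial.leadingCoeff_C]
    exact inv_mul_cancel₀ (by simpa using hS0)
  have := (hSym s).2.2 S' hS'm (by
    intro F' g hg
    rw [apply_eq C F' S' d (by omega)]
    simp only [hP _ F' g hg, S', Polynomial.coeff_C_mul, hS0c, Finset.mul_sum]
    rw [Finset.sum_comm]
    refine Finset.sum_eq_zero fun m _ => ?_
    calc _ = algebraMap (RatFunc C) F'.carrier (S0.leadingCoeff⁻¹ *
          ∑ k : Fin d, φ (a k) * P k m) * ∏ j, F'.δ^[m j] (g j) := by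
            rw [Finset.mul_sum, map_sum, Finset.sum_mul]
            exact Finset.sum_congr rfl fun _ _ => by simp only [map_mul]; ring
      _ = 0 := by rw [hrelK]; simp)
  omega

end
end
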